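/- arXiv:1611.08367 — 10 statements merged into one kernel-verified Lean document; each statement's English description precedes it below -/
import Mathlib

section
/- Let H : 2^V → ℝ be a normalized submodular set function on a finite set V (H(∅) = 0 and H(X) + H(Y) ≥ H(X ∪ Y) + H(X ∩ Y) for all X, Y ⊆ V) and let α ≥ 0. Then f#_α is intersecting submodular, i.e., f#_α(X) + f#_α(Y) ≥ f#_α(X ∪ Y) + f#_α(X ∩ Y) for all X, Y ⊆ V with X ∩ Y ≠ ∅. Moreover, if α ≥ H(V), then f#_α is submodular, i.e., this inequality holds for all X, Y ⊆ V. -/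
/-- `f#_α`: the dual set function, `f#_α(∅) = 0` and `f#_α(X) = α − H(V) + H(X)` for `X ≠ ∅`. -/
noncomputable def fHash {V : Type*} [Fintype V] [DecidableEq V]
    (H : Finset V → ℝ) (α : ℝ) (X : Finset V) : ℝ :=
  if X = ∅ then 0 else α - H Finset.univ + H X

/-- If `H` is a normalized submodular set function and `α ≥ 0`, then `f#_α` is
intersecting submodular; moreover, if `α ≥ H(V)`, `f#_α` is (fully) submodular. -/
theorem stmt_0 {V : Type*} [Fintype V] [DecidableEq V]
    (H : Finset V → ℝ) (hnorm : H ∅ = 0)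
    (hsub : ∀ X Y : Finset V, H (X ∪ Y) + H (X ∩ Y) ≤ H X + H Y)
    (α : ℝ) (hα : 0 ≤ α) :
    (∀ X Y : Finset V, (X ∩ Y).Nonempty →
      fHash H α (X ∪ Y) + fHash H α (X ∩ Y) ≤ fHash H α X + fHash H α Y) ∧
    (H Finset.univ ≤ α →
      ∀ X Y : Finset V,
        fHash H α (X ∪ Y) + fHash H α (X ∩ Y) ≤ fHash H α X + fHash H α Y) := by
  have fHash_of_nonempty : ∀ X : Finset V, X.Nonempty →
      fHash H α X = α - H Finset.univ + H X := fun X hX => if_neg hX.ne_empty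
  have fHash_empty : fHash H α ∅ = 0 := if_pos rfl
  have intersecting : ∀ X Y : Finset V, (X ∩ Y).Nonempty →
      fHash H α (X ∪ Y) + fHash H α (X ∩ Y) ≤ fHash H α X + fHash H α Y := by
    intro X Y hXY
    have hX : X.Nonempty := hXY.mono Finset.inter_subset_left
    have hY : Y.Nonempty := hXY.mono Finset.inter_subset_right
    rw [fHash_of_nonempty _ (hX.mono Finset.subset_union_left), fHash_of_nonempty _ hXY,
      fHash_of_nonempty _ hX, fHash_of_nonempty _ hY]
    linarith [hsub X Y]
  refine ⟨intersecting, fun hV X Y => ?_⟩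
  rcases (X ∩ Y).eq_empty_or_nonempty with hXY | hXY
  · rcases X.eq_empty_or_nonempty with rfl | hX
    · simp [fHash_empty]
    rcases Y.eq_empty_or_nonempty with rfl | hY
    · simp [fHash_empty]
    have h := hsub X Y
    rw [hXY, hnorm] at h
    rw [hXY, fHash_empty, fHash_of_nonempty _ (hX.mono Finset.subset_union_left),
      fHash_of_nonempty _ hX, fHash_of_nonempty _ hY]
    linarith
  · exact intersecting X Y hXY
end

section
/- Let H : 2^V → ℝ be a polymatroid rank function on a finite set V with |V| ≥ 2 and let α ∈ ℝ. Then the base polyhedron B(f#_α, ≤) = { r ∈ ℝ^V : r(X) ≤ f#_α(X) for all X ⊆ V and r(V) = α } is nonempty if and only if α = ĝ_α(V), i.e., if and only if α = min_{P ∈ Π(V)} Σ_{C∈P} f#_α(C). -/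
/-- `H` is a polymatroid rank function: normalized, monotone and submodular. -/
def IsPolymatroid {V : Type*} [Fintype V] [DecidableEq V] (H : Finset V → ℝ) : Prop :=
  H ∅ = 0 ∧ (∀ X Y : Finset V, Y ⊆ X → H Y ≤ H X) ∧
    (∀ X Y : Finset V, H (X ∪ Y) + H (X ∩ Y) ≤ H X + H Y)

/-- `P` is a partition of `X`: a collection of pairwise disjoint nonempty sets with union `X`. -/
def IsPartitionOf {V : Type*} [DecidableEq V] (X : Finset V) (P : Finset (Finset V)) : Prop :=
  (∀ C ∈ P, C.Nonempty) ∧ (∀ C ∈ P, ∀ D ∈ P, C ≠ D → Disjoint C D) ∧ P.biUnion id = X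

/-- The Dilworth truncation `ĝ_α(X) = min_{P ∈ Π(X)} Σ_{C ∈ P} f#_α(C)` (with `ĝ_α(∅) = 0`,
obtained from the empty partition). -/
noncomputable def dilworth {V : Type*} [Fintype V] [DecidableEq V]
    (H : Finset V → ℝ) (α : ℝ) (X : Finset V) : ℝ :=
  sInf { s : ℝ | ∃ P : Finset (Finset V), IsPartitionOf X P ∧ s = ∑ C ∈ P, fHash H α C }

open Finset in
/-- Saturating coordinates one after another: below any set function with `f ∅ = 0` there is a
vector for which every element of `S` lies in a tight set. -/
theorem exists_le_forall_mem_tight {V : Type*} [Fintype V] [DecidableEq V]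
    (f : Finset V → ℝ) (hf : f ∅ = 0) (S : Finset V) :
    ∃ r : V → ℝ, (∀ X : Finset V, ∑ i ∈ X, r i ≤ f X) ∧
      ∀ i ∈ S, ∃ X : Finset V, i ∈ X ∧ ∑ j ∈ X, r j = f X := by
  induction S using Finset.induction_on with
  | empty =>
    refine ⟨fun _ ↦ -∑ Y, |f Y|, fun X ↦ ?_, by simp⟩
    rcases X.eq_empty_or_nonempty with rfl | hX
    · simp [hf]
    have hM : |f X| ≤ ∑ Y, |f Y| :=
      single_le_sum (f := fun Y ↦ |f Y|) (fun Y _ ↦ abs_nonneg _) (mem_univ X)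
    have hcard : (1 : ℝ) ≤ #X := by exact_mod_cast hX.card_pos
    rw [sum_const, nsmul_eq_mul]
    nlinarith [neg_abs_le (f X), abs_nonneg (f X)]
  | insert i S _ ih =>
    obtain ⟨r, hr, hS⟩ := ih
    obtain ⟨T, hT, hmin⟩ := exists_min_image (univ.filter fun X : Finset V ↦ i ∈ X)
      (fun X ↦ f X - ∑ j ∈ X, r j) ⟨univ, by simp⟩
    simp only [mem_filter, mem_univ, true_and] at hT hmin
    set d := f T - ∑ j ∈ T, r j with hd
    have hsum (X : Finset V) :
        ∑ j ∈ X, (r j + if j = i then d else 0) = ∑ j ∈ X, r j + if i ∈ X then d else 0 := by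
      rw [sum_add_distrib, sum_ite_eq']
    refine ⟨fun j ↦ r j + if j = i then d else 0, fun X ↦ ?_, fun j hj ↦ ?_⟩
    · rw [hsum]
      split_ifs with h
      · linarith [hmin X h]
      · linarith [hr X]
    · rcases mem_insert.1 hj with rfl | hj
      · exact ⟨T, hT, by rw [hsum, if_pos hT]; linarith⟩
      · obtain ⟨X, hjX, hX⟩ := hS j hj
        refine ⟨X, hjX, ?_⟩
        rw [hsum]
        split_ifs with h
        · linarith [hmin X h, hr T]
        · linarith

theorem IsPartitionOf.sum_eq {V : Type*} [DecidableEq V] {X : Finset V} {P : Finset (Finset V)}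
    (hP : IsPartitionOf X P) (r : V → ℝ) : ∑ i ∈ X, r i = ∑ C ∈ P, ∑ i ∈ C, r i := by
  rw [← hP.2.2]
  exact Finset.sum_biUnion fun C hC D hD ↦ hP.2.1 C hC D hD

open Finset in
/-- For an intersecting submodular function, some vector below it attains on the whole ground set
the value of a partition. -/
theorem exists_le_sum_eq_partition {V : Type*} [Fintype V] [DecidableEq V]
    (f : Finset V → ℝ) (hf : f ∅ = 0)
    (hsub : ∀ X Y : Finset V, (X ∩ Y).Nonempty → f (X ∪ Y) + f (X ∩ Y) ≤ f X + f Y) :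
    ∃ r : V → ℝ, (∀ X : Finset V, ∑ i ∈ X, r i ≤ f X) ∧
      ∃ P, IsPartitionOf univ P ∧ ∑ i, r i = ∑ C ∈ P, f C := by
  obtain ⟨r, hr, htight⟩ := exists_le_forall_mem_tight f hf univ
  refine ⟨r, hr, ?_⟩
  have hmax (i : V) : ∃ T : Finset V, (i ∈ T ∧ ∑ j ∈ T, r j = f T) ∧
      ∀ X : Finset V, i ∈ X → ∑ j ∈ X, r j = f X → #X ≤ #T := by
    obtain ⟨X, hX⟩ := htight i (mem_univ i)
    obtain ⟨T, hT, h⟩ := exists_max_image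
      (univ.filter fun X : Finset V ↦ i ∈ X ∧ ∑ j ∈ X, r j = f X) card ⟨X, by simpa using hX⟩
    simp only [mem_filter, mem_univ, true_and] at hT h
    exact ⟨T, hT, fun X h₁ h₂ ↦ h X ⟨h₁, h₂⟩⟩
  choose T hT hTmax using hmax
  have hdisj (i j : V) (hij : T i ≠ T j) : Disjoint (T i) (T j) := by
    by_contra h
    rw [disjoint_iff_inter_eq_empty, ← ne_eq, ← nonempty_iff_ne_empty] at h
    have hunion : ∑ k ∈ T i ∪ T j, r k = f (T i ∪ T j) := by
      linarith [sum_union_inter (s₁ := T i) (s₂ := T j) (f := r), hsub _ _ h,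
        hr (T i ∪ T j), hr (T i ∩ T j), (hT i).2, (hT j).2]
    have hi := eq_of_subset_of_card_le subset_union_left
      (hTmax i _ (mem_union_left _ (hT i).1) hunion)
    have hj := eq_of_subset_of_card_le subset_union_right
      (hTmax j _ (mem_union_right _ (hT j).1) hunion)
    exact hij (hi.trans hj.symm)
  have hP : IsPartitionOf univ (univ.image T) := by
    refine ⟨fun C hC ↦ ?_, fun C hC D hD hCD ↦ ?_, ?_⟩
    · obtain ⟨i, -, rfl⟩ := mem_image.1 hC
      exact ⟨i, (hT i).1⟩
    · obtain ⟨i, -, rfl⟩ := mem_image.1 hC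
      obtain ⟨j, -, rfl⟩ := mem_image.1 hD
      exact hdisj i j hCD
    · exact eq_univ_of_forall fun i ↦
        mem_biUnion.2 ⟨T i, mem_image_of_mem T (mem_univ i), (hT i).1⟩
  refine ⟨univ.image T, hP, ?_⟩
  rw [hP.sum_eq]
  refine sum_congr rfl fun C hC ↦ ?_
  obtain ⟨i, -, rfl⟩ := mem_image.1 hC
  exact (hT i).2

theorem fHash_inter_submodular {V : Type*} [Fintype V] [DecidableEq V] {H : Finset V → ℝ}
    (hH : IsPolymatroid H) (α : ℝ) (X Y : Finset V) (h : (X ∩ Y).Nonempty) :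
    fHash H α (X ∪ Y) + fHash H α (X ∩ Y) ≤ fHash H α X + fHash H α Y := by
  have hX := h.mono Finset.inter_subset_left
  have hY := h.mono Finset.inter_subset_right
  have hXY := hX.mono (Finset.subset_union_left (s₂ := Y))
  simp only [fHash, h.ne_empty, hX.ne_empty, hY.ne_empty, hXY.ne_empty, if_false]
  linarith [hH.2.2 X Y]

theorem isPartitionOf_singleton {V : Type*} [DecidableEq V] {X : Finset V} (hX : X.Nonempty) :
    IsPartitionOf X {X} := by
  refine ⟨by simpa using hX, ?_, by simp⟩
  simp only [Finset.mem_singleton]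
  rintro C rfl D rfl h
  exact absurd rfl h

/-- The Dilworth truncation is a lower bound for the value of every partition. -/
theorem dilworth_le {V : Type*} [Fintype V] [DecidableEq V] (H : Finset V → ℝ) (α : ℝ)
    {X : Finset V} {P : Finset (Finset V)} (hP : IsPartitionOf X P) :
    dilworth H α X ≤ ∑ C ∈ P, fHash H α C := by
  refine csInf_le (Set.Finite.bddBelow ?_) ⟨P, hP, rfl⟩
  refine (Set.finite_range fun P : Finset (Finset V) ↦ ∑ C ∈ P, fHash H α C).subset ?_
  rintro s ⟨P, -, rfl⟩
  exact ⟨P, rfl⟩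

/-- The base polyhedron `B(f#_α, ≤)` is nonempty if and only if `α = ĝ_α(V)`. -/
theorem stmt_1 {V : Type*} [Fintype V] [DecidableEq V] (hV : 2 ≤ Fintype.card V)
    (H : Finset V → ℝ) (hH : IsPolymatroid H) (α : ℝ) :
    (∃ r : V → ℝ, (∀ X : Finset V, ∑ i ∈ X, r i ≤ fHash H α X) ∧ ∑ i, r i = α)
      ↔ α = dilworth H α Finset.univ := by
  have : Nonempty V := Fintype.card_pos_iff.1 (by omega)
  have hV₁ : IsPartitionOf Finset.univ {(Finset.univ : Finset V)} :=
    isPartitionOf_singleton Finset.univ_nonempty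
  have hfV : fHash H α Finset.univ = α := by
    simp [fHash, Finset.univ_nonempty.ne_empty]
  constructor
  · rintro ⟨r, hr, hrV⟩
    apply le_antisymm
    · refine le_csInf ⟨_, _, hV₁, rfl⟩ ?_
      rintro s ⟨P, hP, rfl⟩
      exact (hrV.symm.trans (hP.sum_eq r)).trans_le (Finset.sum_le_sum fun C _ ↦ hr C)
    · simpa [hfV] using dilworth_le H α hV₁
  · intro hα
    obtain ⟨r, hr, P, hP, hrP⟩ := exists_le_sum_eq_partition (fHash H α) (by simp [fHash])
      (fHash_inter_submodular hH α)
    exact ⟨r, hr, le_antisymm ((hr _).trans_eq hfV)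
      (hα.trans_le ((dilworth_le H α hP).trans_eq hrP.symm))⟩
end

section
/- Let H : 2^V → ℝ be a polymatroid rank function on a finite set V with |V| ≥ 2. Then the minimum sum-rate for communication for omniscience in the asymptotic model satisfies R_ACO(V) := inf { r(V) : r ∈ RCO(V) } = max_{P ∈ Π′(V)} φ(P), where φ(P) = Σ_{C∈P} (H(V) − H(C)) / (|P| − 1); moreover this infimum is attained by some r ∈ RCO(V). -/
/-- `φ(P) = Σ_{C∈P} (H(V) − H(C)) / (|P| − 1)`. -/
noncomputable def phi {V : Type*} [Fintype V] [DecidableEq V]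
    (H : Finset V → ℝ) (P : Finset (Finset V)) : ℝ :=
  (∑ C ∈ P, (H Finset.univ - H C)) / ((P.card : ℝ) - 1)

/-- The achievable rate region for communication for omniscience:
`r(X) ≥ H(V) − H(V∖X)` for all proper subsets `X ⊊ V`. -/
def RCO {V : Type*} [Fintype V] [DecidableEq V] (H : Finset V → ℝ) : Set (V → ℝ) :=
  { r | ∀ X : Finset V, X ⊂ Finset.univ →
      H Finset.univ - H (Finset.univ \ X) ≤ ∑ i ∈ X, r i }

theorem IsPartitionOf.sum_sum {V : Type*} [DecidableEq V] {X : Finset V}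
    {P : Finset (Finset V)} (hP : IsPartitionOf X P) (r : V → ℝ) :
    ∑ C ∈ P, ∑ i ∈ C, r i = ∑ i ∈ X, r i := by
  obtain ⟨_, hdisj, rfl⟩ := hP
  exact (Finset.sum_biUnion (t := id) hdisj).symm

/-- A vector dominated by `f` on nonempty sets can be raised coordinatewise until every element of
`S` lies in a set on which the domination is tight. -/
theorem exists_saturated_on {V : Type*} [Fintype V] [DecidableEq V] (f : Finset V → ℝ)
    (S : Finset V) :
    ∃ r : V → ℝ, (∀ X : Finset V, X.Nonempty → ∑ i ∈ X, r i ≤ f X) ∧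
      ∀ i ∈ S, ∃ X : Finset V, i ∈ X ∧ ∑ j ∈ X, r j = f X := by
  induction S using Finset.induction_on with
  | empty =>
    refine ⟨fun _ => -∑ X, |f X|, fun X hX => ?_, by simp⟩
    have hle : |f X| ≤ ∑ Y, |f Y| :=
      Finset.single_le_sum (f := fun Y => |f Y|) (fun _ _ => abs_nonneg _) (Finset.mem_univ X)
    have hcard : (1 : ℝ) ≤ X.card := by exact_mod_cast hX.card_pos
    have habs := neg_abs_le (f X)
    have hnonneg := abs_nonneg (f X)
    rw [Finset.sum_const, nsmul_eq_mul]
    nlinarith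
  | insert a S _ ih =>
    obtain ⟨r, hr, hS⟩ := ih
    obtain ⟨T, hT, hmin⟩ := Finset.exists_min_image
      (Finset.univ.filter fun X : Finset V => a ∈ X) (fun X => f X - ∑ i ∈ X, r i)
      ⟨{a}, by simp⟩
    simp only [Finset.mem_filter, Finset.mem_univ, true_and] at hT hmin
    set d := f T - ∑ i ∈ T, r i with hd
    have hd0 : 0 ≤ d := sub_nonneg.2 (hr T ⟨a, hT⟩)
    have hsum : ∀ X : Finset V,
        ∑ i ∈ X, (r i + if i = a then d else 0) = ∑ i ∈ X, r i + if a ∈ X then d else 0 := by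
      intro X
      rw [Finset.sum_add_distrib, Finset.sum_ite_eq']
    have hfeas : ∀ X : Finset V, X.Nonempty →
        ∑ i ∈ X, (r i + if i = a then d else 0) ≤ f X := by
      intro X hX
      rw [hsum]
      split_ifs with haX
      · linarith [hmin X haX]
      · linarith [hr X hX]
    refine ⟨fun i => r i + if i = a then d else 0, hfeas, fun i hi => ?_⟩
    rcases Finset.mem_insert.1 hi with rfl | hi
    · refine ⟨T, hT, ?_⟩
      rw [hsum, if_pos hT]
      linarith
    · obtain ⟨X, hiX, hX⟩ := hS i hi
      refine ⟨X, hiX, le_antisymm (hfeas X ⟨i, hiX⟩) ?_⟩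
      rw [hsum, ← hX]
      split_ifs <;> linarith

/-- For an intersecting submodular `f`, a saturated vector has total weight `∑ C ∈ P, f C` for
some partition `P` of the ground set: the maximal tight sets. -/
theorem exists_partition_sum_eq {V : Type*} [Fintype V] [DecidableEq V] {f : Finset V → ℝ}
    (hf : ∀ X Y : Finset V, (X ∩ Y).Nonempty → f (X ∪ Y) + f (X ∩ Y) ≤ f X + f Y)
    {r : V → ℝ} (hr : ∀ X : Finset V, X.Nonempty → ∑ i ∈ X, r i ≤ f X)
    (ht : ∀ i, ∃ X : Finset V, i ∈ X ∧ ∑ j ∈ X, r j = f X) :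
    ∃ P : Finset (Finset V), IsPartitionOf Finset.univ P ∧ ∑ i, r i = ∑ C ∈ P, f C := by
  classical
  let tight : Finset V → Prop := fun X => X.Nonempty ∧ ∑ j ∈ X, r j = f X
  let P : Finset (Finset V) := Finset.univ.filter fun X => Maximal tight X
  have hP : ∀ C, C ∈ P ↔ Maximal tight C := fun C => by simp [P]
  have hdisj : ∀ C ∈ P, ∀ D ∈ P, C ≠ D → Disjoint C D := by
    intro C hC D hD hne
    rw [hP] at hC hD
    by_contra hCD
    have hint : (C ∩ D).Nonempty := Finset.not_disjoint_iff_nonempty_inter.1 hCD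
    have hunion : (C ∪ D).Nonempty := hC.prop.1.mono Finset.subset_union_left
    have htight : tight (C ∪ D) := by
      refine ⟨hunion, ?_⟩
      have hsum := Finset.sum_union_inter (s₁ := C) (s₂ := D) (f := r)
      linarith [hf C D hint, hr _ hint, hr _ hunion, hC.prop.2, hD.prop.2]
    exact hne ((hC.eq_of_le htight Finset.subset_union_left).trans
      (hD.eq_of_le htight Finset.subset_union_right).symm)
  have hcover : P.biUnion id = Finset.univ := by
    refine Finset.eq_univ_of_forall fun i => ?_
    obtain ⟨X, hiX, hX⟩ := ht i
    obtain ⟨C, hXC, hC⟩ := (Set.toFinite {X | tight X}).exists_le_maximal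
      (show X ∈ {X | tight X} from ⟨⟨i, hiX⟩, hX⟩)
    exact Finset.mem_biUnion.2 ⟨C, (hP C).2 hC, hXC hiX⟩
  have hpart : IsPartitionOf Finset.univ P :=
    ⟨fun C hC => ((hP C).1 hC).prop.1, hdisj, hcover⟩
  refine ⟨P, hpart, ?_⟩
  rw [← hpart.sum_sum r]
  exact Finset.sum_congr rfl fun C hC => ((hP C).1 hC).prop.2

/-- Every partition into at least two parts bounds the sum-rate of an achievable rate vector. -/
theorem phi_le_sum_of_mem_RCO {V : Type*} [Fintype V] [DecidableEq V] {H : Finset V → ℝ}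
    {r : V → ℝ} (hr : r ∈ RCO H) {P : Finset (Finset V)} (hP : IsPartitionOf Finset.univ P)
    (hcard : 2 ≤ P.card) : phi H P ≤ ∑ i, r i := by
  have hcard' : (2 : ℝ) ≤ P.card := by exact_mod_cast hcard
  rw [phi, div_le_iff₀ (by linarith)]
  have hpart : ∀ C ∈ P, H Finset.univ - H C ≤ ∑ i, r i - ∑ i ∈ C, r i := by
    intro C hC
    have hCr := hr (Finset.univ \ C)
      (Finset.sdiff_ssubset (Finset.subset_univ C) (hP.1 C hC))
    rw [Finset.sdiff_sdiff_eq_self (Finset.subset_univ C)] at hCr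
    linarith [Finset.sum_sdiff (f := r) (Finset.subset_univ C)]
  have hsum := Finset.sum_le_sum hpart
  rw [Finset.sum_sub_distrib (fun _ => ∑ i, r i), hP.sum_sum r, Finset.sum_const, nsmul_eq_mul] at hsum
  linarith

/-- If `α` bounds `phi H` on partitions into at least two parts, then some achievable rate vector
has sum-rate `α`. -/
theorem exists_mem_RCO_sum_eq {V : Type*} [Fintype V] [DecidableEq V] [Nonempty V]
    {H : Finset V → ℝ} (hH : ∀ X Y : Finset V, H (X ∪ Y) + H (X ∩ Y) ≤ H X + H Y) {α : ℝ}
    (hα : ∀ P : Finset (Finset V), IsPartitionOf Finset.univ P → 2 ≤ P.card → phi H P ≤ α) :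
    ∃ r ∈ RCO H, ∑ i, r i = α := by
  let f : Finset V → ℝ := fun X => H X - H Finset.univ + α
  obtain ⟨r, hr, ht⟩ := exists_saturated_on f Finset.univ
  obtain ⟨P, hP, hsum⟩ := exists_partition_sum_eq (f := f)
    (fun X Y _ => by simp only [f]; linarith [hH X Y]) hr (fun i => ht i (Finset.mem_univ i))
  have hle : ∑ i, r i ≤ α := by
    have huniv := hr Finset.univ Finset.univ_nonempty
    simp only [f] at huniv
    linarith
  have hge : α ≤ ∑ i, r i := by
    rw [hsum]
    rcases le_or_gt 2 P.card with hcard | hcard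
    · have hcard' : (2 : ℝ) ≤ P.card := by exact_mod_cast hcard
      have hphi := hα P hP hcard
      rw [phi, div_le_iff₀ (by linarith), Finset.sum_sub_distrib, Finset.sum_const,
        nsmul_eq_mul] at hphi
      simp only [f]
      rw [Finset.sum_add_distrib, Finset.sum_sub_distrib, Finset.sum_const, Finset.sum_const,
        nsmul_eq_mul, nsmul_eq_mul]
      linarith
    · have hcover := hP.2.2
      have hPne : P.Nonempty := by
        rw [Finset.nonempty_iff_ne_empty]
        rintro rfl
        exact Finset.univ_nonempty.ne_empty (by simpa using hcover.symm)
      obtain ⟨C, rfl⟩ := Finset.card_eq_one.1 (by have := hPne.card_pos; omega : P.card = 1)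
      have hC : C = Finset.univ := by simpa using hcover
      simp [f, hC]
  refine ⟨r, fun X hX => ?_, le_antisymm hle hge⟩
  have hXr := hr (Finset.univ \ X) (Finset.sdiff_nonempty.2 hX.not_subset)
  simp only [f] at hXr
  linarith [Finset.sum_sdiff (f := r) (Finset.subset_univ X)]

/-- The partition into singletons. -/
theorem isPartitionOf_image_singleton {V : Type*} [DecidableEq V] (X : Finset V) :
    IsPartitionOf X (X.image singleton) := by
  refine ⟨by simp, ?_, by ext; simp⟩
  simp only [Finset.mem_image]
  rintro _ ⟨i, _, rfl⟩ _ ⟨j, _, rfl⟩ hij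
  exact Finset.disjoint_singleton.2 fun h => hij (h ▸ rfl)

/-- The minimum sum-rate in the asymptotic model equals `max_{P ∈ Π′(V)} φ(P)`,
and the infimum of the sum-rate over the achievable rate region is attained. -/
theorem stmt_2 {V : Type*} [Fintype V] [DecidableEq V] (hV : 2 ≤ Fintype.card V)
    (H : Finset V → ℝ) (hH : IsPolymatroid H) :
    ∃ R : ℝ,
      IsGreatest { s : ℝ | ∃ P : Finset (Finset V),
        IsPartitionOf Finset.univ P ∧ 2 ≤ P.card ∧ s = phi H P } R ∧
      IsLeast { s : ℝ | ∃ r ∈ RCO H, ∑ i, r i = s } R := by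
  classical
  have : Nonempty V := Fintype.card_pos_iff.1 (by omega)
  obtain ⟨P, hP, hmax⟩ := Finset.exists_max_image
    (Finset.univ.filter fun P : Finset (Finset V) => IsPartitionOf Finset.univ P ∧ 2 ≤ P.card)
    (phi H) ⟨Finset.univ.image singleton, by
      simpa [isPartitionOf_image_singleton,
        Finset.card_image_of_injective _ Finset.singleton_injective] using hV⟩
  simp only [Finset.mem_filter, Finset.mem_univ, true_and] at hP hmax
  refine ⟨phi H P, ⟨⟨P, hP.1, hP.2, rfl⟩, ?_⟩,
    exists_mem_RCO_sum_eq hH.2.2 fun Q hQ hcard => hmax Q ⟨hQ, hcard⟩, ?_⟩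
  · rintro _ ⟨Q, hQ, hcard, rfl⟩
    exact hmax Q ⟨hQ, hcard⟩
  · rintro _ ⟨r, hr, rfl⟩
    exact phi_le_sum_of_mem_RCO hr hP.1 hP.2
end

section
/- Let H : 2^V → ℝ be an integer-valued polymatroid rank function on a finite set V with |V| ≥ 2. Then the minimum sum-rate for communication for omniscience in the non-asymptotic model satisfies R_NCO(V) := min { r(V) : r ∈ RCO(V) ∩ ℤ^V } = ⌈ max_{P ∈ Π′(V)} φ(P) ⌉, where φ(P) = Σ_{C∈P} (H(V) − H(C)) / (|P| − 1); in particular the minimum over integral achievable rate vectors is attained. -/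
/-- An integer-valued function that is submodular on intersecting pairs bounds an integral vector
whose total is the sum of the function over some partition of the ground set. -/
theorem exists_integral_vector_of_intersecting_submodular {V : Type*} [Fintype V] [DecidableEq V]
    [Nonempty V] (g : Finset V → ℤ)
    (hg : ∀ X Y : Finset V, (X ∩ Y).Nonempty → g (X ∪ Y) + g (X ∩ Y) ≤ g X + g Y) :
    ∃ r : V → ℤ, (∀ X : Finset V, X.Nonempty → ∑ i ∈ X, r i ≤ g X) ∧
      ∃ P : Finset (Finset V), IsPartitionOf Finset.univ P ∧ ∑ C ∈ P, g C = ∑ i, r i := by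
  classical
  obtain ⟨s, ⟨r, hr, hrs⟩, hmax⟩ := Int.exists_greatest_of_bdd
    (P := fun s => ∃ r : V → ℤ, (∀ X : Finset V, X.Nonempty → ∑ i ∈ X, r i ≤ g X) ∧ ∑ i, r i = s)
    ⟨g Finset.univ, by
      rintro s ⟨r, hr, rfl⟩
      exact hr _ Finset.univ_nonempty⟩
    ⟨_, fun _ => -∑ X, |g X|, by
      intro X hX
      have h₁ : |g X| ≤ ∑ X, |g X| :=
        Finset.single_le_sum (f := fun X => |g X|) (fun _ _ => abs_nonneg _) (Finset.mem_univ X)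
      have h₂ : (1 : ℤ) ≤ X.card := by exact_mod_cast hX.card_pos
      have h₃ := neg_abs_le (g X)
      have h₄ := abs_nonneg (g X)
      rw [Finset.sum_const, nsmul_eq_mul]
      nlinarith, rfl⟩
  set tight : Finset V → Prop := fun X => X.Nonempty ∧ ∑ i ∈ X, r i = g X
  have tight_union : ∀ X Y, tight X → tight Y → (X ∩ Y).Nonempty → tight (X ∪ Y) := by
    rintro X Y ⟨hX, hX'⟩ ⟨hY, hY'⟩ hXY
    refine ⟨hX.mono Finset.subset_union_left, ?_⟩
    have h₁ := hg X Y hXY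
    have h₂ := hr _ hXY
    have h₃ := hr (X ∪ Y) (hX.mono Finset.subset_union_left)
    have h₄ := Finset.sum_union_inter (s₁ := X) (s₂ := Y) (f := r)
    linarith
  have exists_tight : ∀ i, ∃ X, i ∈ X ∧ tight X := by
    intro i
    by_contra! hi
    have hle := hmax (∑ j, (r j + if j = i then 1 else 0)) ⟨_, fun X hX => ?_, rfl⟩
    · simp [Finset.sum_add_distrib, hrs] at hle
    · rw [Finset.sum_add_distrib, Finset.sum_ite_eq']
      have h₁ := hr X hX
      split_ifs with hiX
      · have h₂ : ∑ j ∈ X, r j ≠ g X := fun h => hi X hiX ⟨hX, h⟩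
        omega
      · omega
  have eq_of_inter : ∀ C D, Maximal tight C → Maximal tight D → (C ∩ D).Nonempty → C = D := by
    intro C D hC hD hCD
    have hU := tight_union C D hC.prop hD.prop hCD
    exact (hC.eq_of_le hU Finset.subset_union_left).trans
      (hD.eq_of_le hU Finset.subset_union_right).symm
  have disj : ∀ C D, Maximal tight C → Maximal tight D → C ≠ D → Disjoint C D := by
    intro C D hC hD hne
    rw [Finset.disjoint_iff_inter_eq_empty, ← Finset.not_nonempty_iff_eq_empty]
    exact fun h => hne (eq_of_inter C D hC hD h)
  have cover : (Finset.univ.filter (Maximal tight)).biUnion id = Finset.univ := by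
    refine Finset.eq_univ_of_forall fun i => ?_
    obtain ⟨X, hiX, hX⟩ := exists_tight i
    obtain ⟨C, hXC, hC⟩ := (Set.toFinite {X | tight X}).exists_le_maximal hX
    exact Finset.mem_biUnion.2 ⟨C, Finset.mem_filter.2 ⟨Finset.mem_univ _, hC⟩, hXC hiX⟩
  refine ⟨r, hr, Finset.univ.filter (Maximal tight), ⟨?_, ?_, cover⟩, ?_⟩
  · exact fun C hC => (Finset.mem_filter.1 hC).2.prop.1
  · exact fun C hC D hD => disj C D (Finset.mem_filter.1 hC).2 (Finset.mem_filter.1 hD).2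
  · rw [← cover, Finset.sum_biUnion]
    · exact Finset.sum_congr rfl fun C hC => (Finset.mem_filter.1 hC).2.prop.2.symm
    · intro C hC D hD
      exact disj C D (Finset.mem_filter.1 hC).2 (Finset.mem_filter.1 hD).2

/-- The partition into singletons witnesses that a ground set with at least two elements has a
partition into at least two parts. -/
theorem exists_isPartitionOf_univ_two_le_card {V : Type*} [Fintype V] [DecidableEq V]
    (hV : 2 ≤ Fintype.card V) :
    ∃ P : Finset (Finset V), IsPartitionOf Finset.univ P ∧ 2 ≤ P.card := by
  refine ⟨Finset.univ.image singleton, ⟨by simp, ?_, by ext; simp⟩, ?_⟩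
  · simp only [Finset.mem_image, Finset.mem_univ, true_and]
    rintro _ ⟨a, rfl⟩ _ ⟨b, rfl⟩ hab
    exact Finset.disjoint_singleton.2 fun h => hab (by rw [h])
  · rwa [Finset.card_image_of_injective _ Finset.singleton_injective, Finset.card_univ]

/-- For an integer-valued polymatroid rank function, the minimum sum-rate in the
non-asymptotic model equals `⌈ max_{P ∈ Π′(V)} φ(P) ⌉` and is attained by an
integral achievable rate vector. -/
theorem stmt_3 {V : Type*} [Fintype V] [DecidableEq V] (hV : 2 ≤ Fintype.card V)
    (H : Finset V → ℝ) (hH : IsPolymatroid H)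
    (hint : ∀ X : Finset V, ∃ z : ℤ, H X = z) :
    ∃ R : ℝ,
      IsGreatest { s : ℝ | ∃ P : Finset (Finset V),
        IsPartitionOf Finset.univ P ∧ 2 ≤ P.card ∧ s = phi H P } R ∧
      IsLeast { s : ℝ | ∃ r : V → ℤ,
        (fun i => (r i : ℝ)) ∈ RCO H ∧ ∑ i, (r i : ℝ) = s } ((⌈R⌉ : ℤ) : ℝ) := by
  classical
  have : Nonempty V := Fintype.card_pos_iff.1 (by omega)
  obtain ⟨P₀, hP₀⟩ := exists_isPartitionOf_univ_two_le_card hV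
  obtain ⟨Q, hQ, hQmax⟩ := Set.exists_max_image
    {P : Finset (Finset V) | IsPartitionOf Finset.univ P ∧ 2 ≤ P.card} (phi H)
    (Set.toFinite _) ⟨P₀, hP₀⟩
  refine ⟨phi H Q, ⟨⟨Q, hQ.1, hQ.2, rfl⟩, ?_⟩, ?_, ?_⟩
  · rintro _ ⟨P, hP, hcard, rfl⟩
    exact hQmax P ⟨hP, hcard⟩
  · choose h hh using hint
    set α : ℤ := ⌈phi H Q⌉
    obtain ⟨r, hr, P, hP, hsum⟩ := exists_integral_vector_of_intersecting_submodular
      (fun X => h X + α - h Finset.univ) fun X Y _ => by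
        have h₁ := hH.2.2 X Y
        simp only [hh] at h₁
        norm_cast at h₁
        linarith
    have hle : ∑ i, r i ≤ α := by
      have := hr Finset.univ Finset.univ_nonempty
      linarith
    have hge : α ≤ ∑ i, r i := by
      rw [← hsum]
      rcases Nat.lt_or_ge P.card 2 with hcard | hcard
      · have hne : P.Nonempty := by
          rw [Finset.nonempty_iff_ne_empty]
          rintro rfl
          exact Finset.univ_nonempty.ne_empty (by simpa using hP.2.2.symm)
        obtain ⟨C, rfl⟩ := Finset.card_eq_one.1 (by have := hne.card_pos; omega : P.card = 1)
        have hC : C = Finset.univ := by simpa using hP.2.2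
        simp [hC]
      · have h₁ : phi H P ≤ α := (hQmax P ⟨hP, hcard⟩).trans (Int.le_ceil _)
        have hcard' : (2 : ℝ) ≤ P.card := by exact_mod_cast hcard
        rw [phi, div_le_iff₀ (by linarith), Finset.sum_sub_distrib, Finset.sum_const,
          nsmul_eq_mul] at h₁
        simp only [hh] at h₁
        norm_cast at h₁
        rw [Int.subNatNat_eq_coe] at h₁
        push_cast at h₁
        rw [Finset.sum_sub_distrib, Finset.sum_add_distrib, Finset.sum_const, Finset.sum_const,
          nsmul_eq_mul, nsmul_eq_mul]
        linarith
    have hα' : ∑ i, r i = α := le_antisymm hle hge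
    refine ⟨r, fun X hX => ?_, by exact_mod_cast hα'⟩
    have h₁ := hr (Finset.univ \ X) (Finset.sdiff_nonempty.2 hX.2)
    have h₂ := Finset.sum_sdiff (f := r) (Finset.subset_univ X)
    rw [hh, hh]
    beta_reduce
    norm_cast
    linarith
  · rintro _ ⟨r, hr, rfl⟩
    have h₁ := phi_le_sum_of_mem_RCO hr hQ.1 hQ.2
    norm_cast at h₁ ⊢
    exact Int.ceil_le.2 h₁
end

section
/- Let H : 2^V → ℝ be a polymatroid rank function on a finite set V with |V| ≥ 2, and let α ≥ R_ACO(V) := max_{P ∈ Π′(V)} φ(P). Then the Dilworth truncation ĝ_α is a polymatroid rank function (ĝ_α(∅) = 0, ĝ_α(Y) ≤ ĝ_α(X) whenever Y ⊆ X ⊆ V, and ĝ_α(X) + ĝ_α(Y) ≥ ĝ_α(X ∪ Y) + ĝ_α(X ∩ Y) for all X, Y ⊆ V), ĝ_α(V) = α, and the set { r ∈ RCO(V) : r(V) = α } is nonempty and equals { r ∈ ℝ^V : r(X) ≤ ĝ_α(X) for all X ⊆ V and r(V) = α }. -/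
section Partition

variable {V : Type*} [DecidableEq V]

theorem IsPartitionOf.empty : IsPartitionOf (∅ : Finset V) ∅ := by
  simp [IsPartitionOf]

theorem IsPartitionOf.singleton {X : Finset V} (hX : X.Nonempty) : IsPartitionOf X {X} := by
  simp [IsPartitionOf, hX]

theorem exists_isPartitionOf (X : Finset V) : ∃ P, IsPartitionOf X P := by
  rcases X.eq_empty_or_nonempty with rfl | hX
  · exact ⟨∅, .empty⟩
  · exact ⟨{X}, .singleton hX⟩

theorem IsPartitionOf.subset {X C : Finset V} {P : Finset (Finset V)} (hP : IsPartitionOf X P)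
    (hC : C ∈ P) : C ⊆ X := by
  rw [← hP.2.2]
  exact Finset.subset_biUnion_of_mem id hC

theorem IsPartitionOf.disjoint_parts {X Y : Finset V} {P Q : Finset (Finset V)}
    (hP : IsPartitionOf X P) (hQ : IsPartitionOf Y Q) (h : Disjoint X Y) : Disjoint P Q := by
  rw [Finset.disjoint_left]
  intro C hC hC'
  exact (hP.1 C hC).ne_empty (Finset.disjoint_self_iff_empty C |>.1
    (h.mono (hP.subset hC) (hQ.subset hC')))

theorem IsPartitionOf.union {X Y : Finset V} {P Q : Finset (Finset V)}
    (hP : IsPartitionOf X P) (hQ : IsPartitionOf Y Q) (h : Disjoint X Y) :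
    IsPartitionOf (X ∪ Y) (P ∪ Q) := by
  refine ⟨?_, ?_, ?_⟩
  · intro C hC
    rcases Finset.mem_union.1 hC with hC | hC
    exacts [hP.1 C hC, hQ.1 C hC]
  · intro C hC D hD hne
    rcases Finset.mem_union.1 hC with hC | hC <;> rcases Finset.mem_union.1 hD with hD | hD
    · exact hP.2.1 C hC D hD hne
    · exact h.mono (hP.subset hC) (hQ.subset hD)
    · exact (h.mono (hP.subset hD) (hQ.subset hC)).symm
    · exact hQ.2.1 C hC D hD hne
  · rw [Finset.union_biUnion, hP.2.2, hQ.2.2]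

theorem IsPartitionOf.of_insert {X C : Finset V} {P : Finset (Finset V)}
    (hP : IsPartitionOf X (insert C P)) (hC : C ∉ P) :
    ∃ Y, IsPartitionOf Y P ∧ Disjoint C Y ∧ C ∪ Y = X := by
  obtain ⟨hne, hdisj, rfl⟩ := hP
  refine ⟨P.biUnion id, ⟨fun D hD => hne D (Finset.mem_insert_of_mem hD), fun D hD E hE =>
    hdisj D (Finset.mem_insert_of_mem hD) E (Finset.mem_insert_of_mem hE), rfl⟩, ?_,
    Finset.biUnion_insert.symm⟩
  rw [Finset.disjoint_biUnion_right]
  intro D hD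
  exact hdisj C (Finset.mem_insert_self _ _) D (Finset.mem_insert_of_mem hD) fun h => hC (h ▸ hD)

theorem IsPartitionOf.eq_empty {X : Finset V} (hP : IsPartitionOf X ∅) : X = ∅ := by
  simpa using hP.2.2.symm

end Partition

/-- Greedy construction of a point in the base polyhedron of a submodular function. -/
theorem exists_base_of_submodular {V : Type*} [DecidableEq V] {g : Finset V → ℝ} (h0 : g ∅ = 0)
    (hg : ∀ X Y : Finset V, g (X ∪ Y) + g (X ∩ Y) ≤ g X + g Y) (S : Finset V) :
    ∃ r : V → ℝ, (∀ X ⊆ S, ∑ i ∈ X, r i ≤ g X) ∧ ∑ i ∈ S, r i = g S := by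
  induction S using Finset.induction_on with
  | empty =>
    refine ⟨0, fun X hX => ?_, by simp [h0]⟩
    simp [Finset.subset_empty.1 hX, h0]
  | insert a S ha ih =>
    obtain ⟨r, hr, hrS⟩ := ih
    have hupd (X : Finset V) (hX : a ∉ X) (t : ℝ) :
        ∑ i ∈ X, Function.update r a t i = ∑ i ∈ X, r i := by
      refine Finset.sum_congr rfl fun i hi => Function.update_of_ne ?_ _ _
      rintro rfl
      exact hX hi
    refine ⟨Function.update r a (g (insert a S) - g S), fun X hX => ?_, ?_⟩
    · by_cases haX : a ∈ X
      · have hXS : X.erase a ⊆ S := Finset.subset_insert_iff.1 hX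
        have hu : X ∪ S = insert a S := by grind
        have hi : X ∩ S = X.erase a := by grind
        have hs := hg X S
        rw [hu, hi] at hs
        rw [← Finset.add_sum_erase _ _ haX, hupd _ (Finset.notMem_erase a X),
          Function.update_self]
        linarith [hr _ hXS]
      · rw [hupd X haX]
        exact hr X ((Finset.subset_insert_iff_of_notMem haX).1 hX)
    · rw [Finset.sum_insert ha, hupd S ha, Function.update_self, hrS]
      ring

section Dilworth

variable {V : Type*} [Fintype V] [DecidableEq V] {H : Finset V → ℝ} {α : ℝ}

theorem finite_setOf_partition_sum (H : Finset V → ℝ) (α : ℝ) (X : Finset V) :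
    { s : ℝ | ∃ P : Finset (Finset V),
      IsPartitionOf X P ∧ s = ∑ C ∈ P, fHash H α C }.Finite :=
  (Set.finite_range fun P : Finset (Finset V) => ∑ C ∈ P, fHash H α C).subset
    fun _ ⟨P, _, h⟩ => ⟨P, h.symm⟩

theorem dilworth_le_sum {X : Finset V} {P : Finset (Finset V)} (hP : IsPartitionOf X P) :
    dilworth H α X ≤ ∑ C ∈ P, fHash H α C :=
  csInf_le (finite_setOf_partition_sum H α X).bddBelow ⟨P, hP, rfl⟩

theorem exists_dilworth_eq_sum (H : Finset V → ℝ) (α : ℝ) (X : Finset V) :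
    ∃ P, IsPartitionOf X P ∧ dilworth H α X = ∑ C ∈ P, fHash H α C := by
  obtain ⟨P, hP⟩ := exists_isPartitionOf X
  have hne : { s : ℝ | ∃ P : Finset (Finset V),
      IsPartitionOf X P ∧ s = ∑ C ∈ P, fHash H α C }.Nonempty := ⟨_, P, hP, rfl⟩
  exact hne.csInf_mem (finite_setOf_partition_sum H α X)

@[simp]
theorem fHash_empty : fHash H α ∅ = 0 := by simp [fHash]

theorem fHash_of_nonempty {X : Finset V} (hX : X.Nonempty) :
    fHash H α X = α - H Finset.univ + H X := by simp [fHash, hX.ne_empty]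

@[simp]
theorem dilworth_empty : dilworth H α ∅ = 0 := by
  obtain ⟨P, hP, h⟩ := exists_dilworth_eq_sum H α ∅
  obtain rfl : P = ∅ := by
    rw [Finset.eq_empty_iff_forall_notMem]
    intro C hC
    exact (hP.1 C hC).ne_empty (Finset.subset_empty.1 (hP.subset hC))
  simpa using h

theorem dilworth_le_fHash (X : Finset V) : dilworth H α X ≤ fHash H α X := by
  rcases X.eq_empty_or_nonempty with rfl | hX
  · simp
  · simpa using dilworth_le_sum (H := H) (α := α) (IsPartitionOf.singleton hX)

theorem dilworth_union_le {X Y : Finset V} (h : Disjoint X Y) :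
    dilworth H α (X ∪ Y) ≤ dilworth H α X + dilworth H α Y := by
  obtain ⟨P, hP, hPs⟩ := exists_dilworth_eq_sum H α X
  obtain ⟨Q, hQ, hQs⟩ := exists_dilworth_eq_sum H α Y
  rw [hPs, hQs, ← Finset.sum_union (hP.disjoint_parts hQ h)]
  exact dilworth_le_sum (hP.union hQ h)

theorem fHash_union_add_inter_le
    (hH : ∀ X Y : Finset V, H (X ∪ Y) + H (X ∩ Y) ≤ H X + H Y)
    {X Y : Finset V} (h : (X ∩ Y).Nonempty) :
    fHash H α (X ∪ Y) + fHash H α (X ∩ Y) ≤ fHash H α X + fHash H α Y := by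
  have hX : X.Nonempty := h.mono Finset.inter_subset_left
  rw [fHash_of_nonempty h, fHash_of_nonempty hX, fHash_of_nonempty (h.mono Finset.inter_subset_right),
    fHash_of_nonempty (hX.mono Finset.subset_union_left)]
  linarith [hH X Y]

theorem dilworth_union_add_inter_le_add_fHash
    (hH : ∀ X Y : Finset V, H (X ∪ Y) + H (X ∩ Y) ≤ H X + H Y) (X D : Finset V) :
    dilworth H α (X ∪ D) + dilworth H α (X ∩ D) ≤ dilworth H α X + fHash H α D := by
  obtain ⟨P, hP, h⟩ := exists_dilworth_eq_sum H α X
  rw [h]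
  clear h
  induction P using Finset.induction_on generalizing X D with
  | empty =>
    obtain rfl := hP.eq_empty
    simpa using dilworth_le_fHash D
  | insert C P hCP ih =>
    obtain ⟨X, hP', hCX, rfl⟩ := hP.of_insert hCP
    rw [Finset.sum_insert hCP]
    rcases (C ∩ D).eq_empty_or_nonempty with hCD | hCD
    · have hu := dilworth_union_le (H := H) (α := α)
        (Finset.disjoint_union_right.2 ⟨hCX, Finset.disjoint_iff_inter_eq_empty.2 hCD⟩)
      rw [Finset.union_inter_distrib_right, hCD, Finset.empty_union, Finset.union_assoc]
      linarith [ih X D hP', dilworth_le_fHash (H := H) (α := α) C]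
    · have hsub := fHash_union_add_inter_le (α := α) hH hCD
      have hi := ih X (C ∪ D) hP'
      rw [← Finset.union_assoc, Finset.union_comm X C, Finset.inter_union_distrib_left X,
        Finset.disjoint_iff_inter_eq_empty.1 hCX.symm, Finset.empty_union] at hi
      have hu := dilworth_union_le (H := H) (α := α)
        (hCX.mono (Finset.inter_subset_left (s₂ := D)) (Finset.inter_subset_left (s₂ := D)))
      rw [← Finset.union_inter_distrib_right] at hu
      linarith [dilworth_le_fHash (H := H) (α := α) (C ∩ D)]

/-- The Dilworth truncation is submodular. -/
theorem dilworth_union_add_inter_le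
    (hH : ∀ X Y : Finset V, H (X ∪ Y) + H (X ∩ Y) ≤ H X + H Y) (X Y : Finset V) :
    dilworth H α (X ∪ Y) + dilworth H α (X ∩ Y) ≤ dilworth H α X + dilworth H α Y := by
  obtain ⟨Q, hQ, h⟩ := exists_dilworth_eq_sum H α Y
  rw [h]
  clear h
  induction Q using Finset.induction_on generalizing Y with
  | empty =>
    obtain rfl := hQ.eq_empty
    simp
  | insert D Q hDQ ih =>
    obtain ⟨Y, hQ', hDY, rfl⟩ := hQ.of_insert hDQ
    rw [Finset.sum_insert hDQ]
    have hs := dilworth_union_add_inter_le_add_fHash (α := α) hH (X ∪ Y) D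
    rw [Finset.union_inter_distrib_right, Finset.disjoint_iff_inter_eq_empty.1 hDY.symm,
      Finset.union_empty, Finset.union_assoc, Finset.union_comm Y D] at hs
    have hu := dilworth_union_le (H := H) (α := α)
      (hDY.mono (Finset.inter_subset_right (s₁ := X)) (Finset.inter_subset_right (s₁ := X)))
    rw [← Finset.inter_union_distrib_left] at hu
    linarith [ih Y hQ']

theorem dilworth_mono (hH : ∀ X Y : Finset V, Y ⊆ X → H Y ≤ H X)
    (h0 : ∀ X, 0 ≤ fHash H α X) {X Y : Finset V} (hYX : Y ⊆ X) :
    dilworth H α Y ≤ dilworth H α X := by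
  have hf (C : Finset V) : fHash H α (Y ∩ C) ≤ fHash H α C := by
    rcases (Y ∩ C).eq_empty_or_nonempty with h | h
    · simpa [h] using h0 C
    · rw [fHash_of_nonempty h, fHash_of_nonempty (h.mono Finset.inter_subset_right)]
      linarith [hH C (Y ∩ C) Finset.inter_subset_right]
  obtain ⟨P, hP, h⟩ := exists_dilworth_eq_sum H α X
  rw [h, ← Finset.inter_eq_left.2 hYX]
  clear h hYX
  induction P using Finset.induction_on generalizing X with
  | empty =>
    obtain rfl := hP.eq_empty
    simp
  | insert C P hCP ih =>
    obtain ⟨X, hP', hCX, rfl⟩ := hP.of_insert hCP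
    rw [Finset.sum_insert hCP, Finset.inter_union_distrib_left]
    have hu := dilworth_union_le (H := H) (α := α)
      (hCX.mono (Finset.inter_subset_right (s₁ := Y)) (Finset.inter_subset_right (s₁ := Y)))
    linarith [dilworth_le_fHash (H := H) (α := α) (Y ∩ C), hf C, ih hP']

theorem le_dilworth_iff {r : V → ℝ} :
    (∀ X, ∑ i ∈ X, r i ≤ dilworth H α X) ↔ ∀ X, ∑ i ∈ X, r i ≤ fHash H α X := by
  refine ⟨fun h X => (h X).trans (dilworth_le_fHash X), fun h X => ?_⟩
  obtain ⟨P, hP, hs⟩ := exists_dilworth_eq_sum H α X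
  have hd : (P : Set (Finset V)).PairwiseDisjoint id := fun C hC D hD => hP.2.1 C hC D hD
  rw [hs, ← hP.2.2, Finset.sum_biUnion hd]
  exact Finset.sum_le_sum fun C _ => h C

theorem mem_RCO_iff {r : V → ℝ} (hr : ∑ i, r i = α) :
    r ∈ RCO H ↔ ∀ X, ∑ i ∈ X, r i ≤ fHash H α X := by
  have hsum (X : Finset V) : ∑ i ∈ Finset.univ \ X, r i = α - ∑ i ∈ X, r i := by
    rw [← hr, ← Finset.sum_sdiff (Finset.subset_univ X)]
    ring
  constructor
  · intro h X
    rcases X.eq_empty_or_nonempty with rfl | hX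
    · simp
    · have := h (Finset.univ \ X)
        (Finset.sdiff_ssubset (Finset.subset_univ X) hX)
      rw [Finset.sdiff_sdiff_eq_self (Finset.subset_univ X), hsum] at this
      rw [fHash_of_nonempty hX]
      linarith
  · intro h X hX
    have := h (Finset.univ \ X)
    rw [hsum, fHash_of_nonempty (Finset.sdiff_nonempty.2 hX.2)] at this
    linarith

/-- If every partition into at least two parts has `φ(P) ≤ α`, then every partition of the
ground set has `f#_α[P] ≥ α`. -/
theorem le_sum_fHash [Nonempty V]
    (hα : ∀ P : Finset (Finset V), IsPartitionOf Finset.univ P → 2 ≤ P.card → phi H P ≤ α)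
    {P : Finset (Finset V)} (hP : IsPartitionOf Finset.univ P) :
    α ≤ ∑ C ∈ P, fHash H α C := by
  have hsum : ∑ C ∈ P, fHash H α C =
      P.card * α - ∑ C ∈ P, (H Finset.univ - H C) := by
    rw [← nsmul_eq_mul, ← Finset.sum_const, ← Finset.sum_sub_distrib]
    exact Finset.sum_congr rfl fun C hC => by rw [fHash_of_nonempty (hP.1 C hC)]; ring
  by_cases hc : 2 ≤ P.card
  · have hpos : (0 : ℝ) < P.card - 1 := by
      have : (2 : ℝ) ≤ P.card := by exact_mod_cast hc
      linarith
    have h := hα P hP hc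
    rw [phi, div_le_iff₀ hpos] at h
    rw [hsum]
    linarith
  · have hne : P.Nonempty := by
      rw [Finset.nonempty_iff_ne_empty]
      rintro rfl
      exact Finset.univ_nonempty.ne_empty (by simpa using hP.2.2.symm)
    have hc1 : P.card = 1 := by have := hne.card_pos; omega
    obtain ⟨C, rfl⟩ := Finset.card_eq_one.1 hc1
    obtain rfl : C = Finset.univ := by simpa using hP.2.2
    simp [fHash_of_nonempty Finset.univ_nonempty]

theorem dilworth_univ [Nonempty V]
    (hα : ∀ P : Finset (Finset V), IsPartitionOf Finset.univ P → 2 ≤ P.card → phi H P ≤ α) :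
    dilworth H α Finset.univ = α := by
  apply le_antisymm
  · simpa [fHash_of_nonempty Finset.univ_nonempty] using
      dilworth_le_fHash (H := H) (α := α) Finset.univ
  · obtain ⟨P, hP, h⟩ := exists_dilworth_eq_sum H α Finset.univ
    exact (le_sum_fHash hα hP).trans_eq h.symm

theorem phi_nonneg (hH : ∀ X Y : Finset V, Y ⊆ X → H Y ≤ H X) {P : Finset (Finset V)}
    (hP : 2 ≤ P.card) : 0 ≤ phi H P := by
  have : (2 : ℝ) ≤ P.card := by exact_mod_cast hP
  exact div_nonneg (Finset.sum_nonneg fun C _ => sub_nonneg.2 (hH _ _ (Finset.subset_univ C)))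
    (by linarith)

theorem fHash_nonneg [Nonempty V] (hH : ∀ X Y : Finset V, Y ⊆ X → H Y ≤ H X) (h0 : 0 ≤ α)
    (hα : ∀ P : Finset (Finset V), IsPartitionOf Finset.univ P → 2 ≤ P.card → phi H P ≤ α)
    (X : Finset V) : 0 ≤ fHash H α X := by
  rcases X.eq_empty_or_nonempty with rfl | hX
  · simp
  rcases (Finset.univ \ X).eq_empty_or_nonempty with hc | hc
  · obtain rfl : X = Finset.univ := Finset.univ_subset_iff.1 (Finset.sdiff_eq_empty_iff_subset.1 hc)
    simpa [fHash_of_nonempty hX] using h0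
  · have hd : Disjoint X (Finset.univ \ X) := Finset.disjoint_sdiff
    have hP := (IsPartitionOf.singleton hX).union (.singleton hc) hd
    have hdp := (IsPartitionOf.singleton hX).disjoint_parts (.singleton hc) hd
    rw [Finset.union_sdiff_of_subset (Finset.subset_univ X)] at hP
    have h := le_sum_fHash hα hP
    rw [Finset.sum_union hdp, Finset.sum_singleton, Finset.sum_singleton,
      fHash_of_nonempty hc] at h
    linarith [hH _ _ (Finset.subset_univ (Finset.univ \ X))]

end Dilworth

/-- For every `α ≥ R_ACO(V)`, the Dilworth truncation `ĝ_α` is a polymatroid rank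
function, `ĝ_α(V) = α`, and the achievable rate vectors with sum-rate `α` form the
nonempty base polyhedron `B(ĝ_α, ≤)`. -/
theorem stmt_4 {V : Type*} [Fintype V] [DecidableEq V] (hV : 2 ≤ Fintype.card V)
    (H : Finset V → ℝ) (hH : IsPolymatroid H) (R α : ℝ)
    (hR : IsGreatest { s : ℝ | ∃ P : Finset (Finset V),
      IsPartitionOf Finset.univ P ∧ 2 ≤ P.card ∧ s = phi H P } R)
    (hα : R ≤ α) :
    dilworth H α ∅ = 0 ∧
    (∀ X Y : Finset V, Y ⊆ X → dilworth H α Y ≤ dilworth H α X) ∧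
    (∀ X Y : Finset V,
      dilworth H α (X ∪ Y) + dilworth H α (X ∩ Y) ≤ dilworth H α X + dilworth H α Y) ∧
    dilworth H α Finset.univ = α ∧
    { r : V → ℝ | r ∈ RCO H ∧ ∑ i, r i = α }.Nonempty ∧
    { r : V → ℝ | r ∈ RCO H ∧ ∑ i, r i = α } =
      { r : V → ℝ | (∀ X : Finset V, ∑ i ∈ X, r i ≤ dilworth H α X) ∧ ∑ i, r i = α } := by
  have : Nonempty V := Fintype.card_pos_iff.1 (by omega)
  obtain ⟨-, hmono, hsub⟩ := hH
  have hφ : ∀ P : Finset (Finset V), IsPartitionOf Finset.univ P → 2 ≤ P.card → phi H P ≤ α :=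
    fun P hP hc => (hR.2 ⟨P, hP, hc, rfl⟩).trans hα
  have h0 : 0 ≤ α := by
    obtain ⟨P, -, hc, hPR⟩ := hR.1
    exact (hPR ▸ phi_nonneg hmono hc : 0 ≤ R).trans hα
  have huniv := dilworth_univ hφ
  have heq : { r : V → ℝ | r ∈ RCO H ∧ ∑ i, r i = α } =
      { r : V → ℝ | (∀ X : Finset V, ∑ i ∈ X, r i ≤ dilworth H α X) ∧ ∑ i, r i = α } := by
    ext r
    exact and_congr_left fun hr => (mem_RCO_iff hr).trans le_dilworth_iff.symm
  refine ⟨dilworth_empty, fun X Y => dilworth_mono hmono (fHash_nonneg hmono h0 hφ),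
    dilworth_union_add_inter_le hsub, huniv, ?_, heq⟩
  rw [heq]
  obtain ⟨r, hr, hrs⟩ := exists_base_of_submodular (dilworth_empty (H := H) (α := α))
    (dilworth_union_add_inter_le hsub) Finset.univ
  exact ⟨r, fun X => hr X (Finset.subset_univ X), hrs.trans huniv⟩
end

section
/- Let H : 2^V → ℝ be an integer-valued polymatroid rank function on a finite set V with |V| ≥ 2 (the finite linear source model). Then there exists an integral optimal rate vector for the non-asymptotic model: there is r ∈ ℤ^V with r ∈ RCO(V) and r(V) = ⌈ max_{P ∈ Π′(V)} φ(P) ⌉. -/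
/-- An integer vector below `f` on nonempty sets, of maximum total weight. -/
lemma exists_maximal_int_vector {V : Type*} [Fintype V] [DecidableEq V] [Nonempty V]
    (f : Finset V → ℤ) :
    ∃ r : V → ℤ, (∀ X : Finset V, X.Nonempty → ∑ i ∈ X, r i ≤ f X) ∧
      ∀ s : V → ℤ, (∀ X : Finset V, X.Nonempty → ∑ i ∈ X, s i ≤ f X) →
        ∑ i, s i ≤ ∑ i, r i := by
  obtain ⟨_, ⟨r, hr, rfl⟩, hmax⟩ := Int.exists_greatest_of_bdd
    (P := fun z => ∃ r : V → ℤ, (∀ X : Finset V, X.Nonempty → ∑ i ∈ X, r i ≤ f X) ∧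
      ∑ i, r i = z)
    ⟨f Finset.univ, by
      rintro _ ⟨r, hr, rfl⟩
      exact hr _ Finset.univ_nonempty⟩
    (by
      refine ⟨_, fun _ => -∑ Y, |f Y|, fun X hX => ?_, rfl⟩
      have hXle : |f X| ≤ ∑ Y, |f Y| :=
        Finset.single_le_sum (f := fun Y => |f Y|) (fun _ _ => abs_nonneg _) (Finset.mem_univ X)
      have hcard : (1 : ℤ) ≤ X.card := by exact_mod_cast hX.card_pos
      have habs := neg_abs_le (f X)
      have hnonneg := abs_nonneg (f X)
      rw [Finset.sum_const, nsmul_eq_mul]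
      nlinarith)
  exact ⟨r, hr, fun s hs => hmax _ ⟨s, hs, rfl⟩⟩

/-- An integer-valued intersecting submodular function that no partition undercuts on the whole
ground set has an integral base. -/
lemma exists_integral_base {V : Type*} [Fintype V] [DecidableEq V] [Nonempty V]
    (f : Finset V → ℤ)
    (hf : ∀ X Y : Finset V, (X ∩ Y).Nonempty → f (X ∪ Y) + f (X ∩ Y) ≤ f X + f Y)
    (hP : ∀ P : Finset (Finset V), IsPartitionOf Finset.univ P →
      f Finset.univ ≤ ∑ C ∈ P, f C) :
    ∃ r : V → ℤ, (∀ X : Finset V, X.Nonempty → ∑ i ∈ X, r i ≤ f X) ∧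
      ∑ i, r i = f Finset.univ := by
  classical
  obtain ⟨r, hr, hmax⟩ := exists_maximal_int_vector f
  refine ⟨r, hr, le_antisymm (hr _ Finset.univ_nonempty) ?_⟩
  let Tight : Finset V → Prop := fun X => X.Nonempty ∧ ∑ i ∈ X, r i = f X
  have exists_tight : ∀ i, ∃ X, Tight X ∧ i ∈ X := by
    intro i
    by_contra! h
    have hlt := hmax (fun j => r j + if j = i then 1 else 0) fun X hX => by
      rw [Finset.sum_add_distrib, Finset.sum_ite_eq']
      have hle := hr X hX
      split_ifs with hi
      · have hne : ∑ j ∈ X, r j ≠ f X := fun he => h X ⟨hX, he⟩ hi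
        omega
      · simpa using hle
    rw [Finset.sum_add_distrib, Finset.sum_ite_eq'] at hlt
    simp at hlt
  have tight_union : ∀ X Y, Tight X → Tight Y → (X ∩ Y).Nonempty → Tight (X ∪ Y) := by
    rintro X Y ⟨hX, hXf⟩ ⟨hY, hYf⟩ hXY
    have hunion : (X ∪ Y).Nonempty := hX.mono Finset.subset_union_left
    refine ⟨hunion, ?_⟩
    have hsum := Finset.sum_union_inter (s₁ := X) (s₂ := Y) (f := r)
    have h₁ := hf X Y hXY
    have h₂ := hr _ hXY
    have h₃ := hr _ hunion
    omega
  let P : Finset (Finset V) := Finset.univ.filter (Maximal Tight)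
  have hmem : ∀ C, C ∈ P ↔ Maximal Tight C := by simp [P]
  have hdisj : ∀ C ∈ P, ∀ D ∈ P, C ≠ D → Disjoint C D := by
    intro C hC D hD hne
    rw [hmem] at hC hD
    by_contra hCD
    have hU := tight_union C D hC.prop hD.prop (Finset.not_disjoint_iff_nonempty_inter.mp hCD)
    exact hne ((hC.eq_of_le hU Finset.subset_union_left).trans
      (hD.eq_of_le hU Finset.subset_union_right).symm)
  have hunion : P.biUnion id = Finset.univ := by
    refine Finset.eq_univ_of_forall fun i => ?_
    obtain ⟨X, hX, hi⟩ := exists_tight i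
    obtain ⟨C, hXC, hC⟩ := Finite.exists_le_maximal hX
    exact Finset.mem_biUnion.mpr ⟨C, (hmem C).mpr hC, hXC hi⟩
  calc f Finset.univ ≤ ∑ C ∈ P, f C :=
        hP P ⟨fun C hC => ((hmem C).mp hC).prop.1, hdisj, hunion⟩
    _ = ∑ C ∈ P, ∑ i ∈ C, r i :=
        Finset.sum_congr rfl fun C hC => ((hmem C).mp hC).prop.2.symm
    _ = ∑ i, r i := by
        rw [← hunion]
        exact (Finset.sum_biUnion fun C hC D hD hne => hdisj C hC D hD hne).symm

/-- In the finite linear source model (integer-valued `H`), there exists an integral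
optimal rate vector for the non-asymptotic model: an integral achievable rate vector
with sum-rate `⌈ max_{P ∈ Π′(V)} φ(P) ⌉`. -/
theorem stmt_6 {V : Type*} [Fintype V] [DecidableEq V] (hV : 2 ≤ Fintype.card V)
    (H : Finset V → ℝ) (hH : IsPolymatroid H)
    (hint : ∀ X : Finset V, ∃ z : ℤ, H X = z) (R : ℝ)
    (hR : IsGreatest { s : ℝ | ∃ P : Finset (Finset V),
      IsPartitionOf Finset.univ P ∧ 2 ≤ P.card ∧ s = phi H P } R) :
    ∃ r : V → ℤ, (fun i => (r i : ℝ)) ∈ RCO H ∧ ∑ i, (r i : ℝ) = ((⌈R⌉ : ℤ) : ℝ) := by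
  choose h hh using hint
  obtain ⟨-, -, hsub⟩ := hH
  have : Nonempty V := Fintype.card_pos_iff.mp (zero_lt_two.trans_le hV)
  obtain ⟨r, hr, hsum⟩ := exists_integral_base (fun X => h X + ⌈R⌉ - h Finset.univ)
    (by
      intro X Y _
      have hXY := hsub X Y
      simp only [hh] at hXY
      norm_cast at hXY
      linarith)
    (by
      intro P hP
      rcases Nat.lt_or_ge P.card 2 with hcard | hcard
      · have hPne : P.Nonempty := by
          rw [Finset.nonempty_iff_ne_empty]
          rintro rfl
          exact Finset.univ_nonempty.ne_empty hP.2.2.symm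
        obtain ⟨C, rfl⟩ := Finset.card_eq_one.mp
          (le_antisymm (Nat.le_of_lt_succ hcard) hPne.card_pos)
        have hC : C = Finset.univ := by simpa using hP.2.2
        simp [hC]
      · have hle : phi H P ≤ (⌈R⌉ : ℝ) := (hR.2 ⟨P, hP, hcard, rfl⟩).trans (Int.le_ceil R)
        have hcard' : (2 : ℝ) ≤ P.card := by exact_mod_cast hcard
        rw [phi, div_le_iff₀ (by linarith)] at hle
        simp only [hh, Finset.sum_sub_distrib, Finset.sum_const, nsmul_eq_mul] at hle
        rify
        simp only [Finset.sum_sub_distrib, Finset.sum_add_distrib, Finset.sum_const,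
          nsmul_eq_mul]
        linarith)
  have hsum' : ∑ i, r i = ⌈R⌉ := by simpa using hsum
  refine ⟨r, fun X hX => ?_, by exact_mod_cast hsum'⟩
  have hne : (Finset.univ \ X).Nonempty := Finset.sdiff_nonempty.mpr hX.not_subset
  have hle := hr _ hne
  have hsplit := Finset.sum_sdiff (f := r) (Finset.subset_univ X)
  simp only [hh]
  norm_cast
  linarith
end

section
/- Let H : 2^V → ℝ be an integer-valued polymatroid rank function on a finite set V with |V| ≥ 2, and let P ∈ Π′(V) be a partition attaining R_ACO(V) := max_{P′ ∈ Π′(V)} φ(P′), i.e., φ(P) = R_ACO(V). Then there exists a fractional optimal rate vector implementable by (|P| − 1)-packet-splitting: there is r ∈ RCO(V) with r(V) = R_ACO(V) such that (|P| − 1) · r_i ∈ ℤ for every i ∈ V. -/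
/-- An intersecting submodular integer function `g` such that no partition of the ground set has
total value less than `g univ` has an integral base. -/
theorem exists_int_base_of_intersecting_submodular {V : Type*} [Fintype V] [DecidableEq V]
    [Nonempty V] (g : Finset V → ℤ)
    (hsub : ∀ X Y : Finset V, (X ∩ Y).Nonempty → g (X ∪ Y) + g (X ∩ Y) ≤ g X + g Y)
    (hpart : ∀ Q : Finset (Finset V), IsPartitionOf Finset.univ Q →
      g Finset.univ ≤ ∑ C ∈ Q, g C) :
    ∃ x : V → ℤ, (∀ X : Finset V, X.Nonempty → ∑ i ∈ X, x i ≤ g X) ∧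
      ∑ i, x i = g Finset.univ := by
  obtain ⟨n, ⟨x, hx, rfl⟩, hmax⟩ := Int.exists_greatest_of_bdd
    (P := fun n => ∃ x : V → ℤ, (∀ X : Finset V, X.Nonempty → ∑ i ∈ X, x i ≤ g X) ∧
      ∑ i, x i = n)
    ⟨g Finset.univ, by
      rintro _ ⟨x, hx, rfl⟩
      exact hx _ Finset.univ_nonempty⟩
    ⟨_, fun _ => -∑ X, |g X|, fun X hX => by
      have h1 : |g X| ≤ ∑ X, |g X| :=
        Finset.single_le_sum (f := fun X => |g X|) (fun _ _ => abs_nonneg _) (Finset.mem_univ X)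
      have h2 : (1 : ℤ) ≤ X.card := by exact_mod_cast hX.card_pos
      have h3 := neg_abs_le (g X)
      have h4 := abs_nonneg (g X)
      rw [Finset.sum_const, nsmul_eq_mul]
      nlinarith, rfl⟩
  refine ⟨x, hx, le_antisymm (hx _ Finset.univ_nonempty) ?_⟩
  let T : Finset (Finset V) := {X | X.Nonempty ∧ ∑ i ∈ X, x i = g X}
  have hT : ∀ X, X ∈ T ↔ X.Nonempty ∧ ∑ i ∈ X, x i = g X := fun X => by simp [T]
  have hcover : ∀ i, ∃ X ∈ T, i ∈ X := by
    intro i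
    by_contra! hi
    have hsum : ∀ X : Finset V, ∑ j ∈ X, (x j + if j = i then 1 else 0) =
        ∑ j ∈ X, x j + if i ∈ X then 1 else 0 := fun X => by
      rw [Finset.sum_add_distrib, Finset.sum_ite_eq']
    have := hmax _ ⟨fun j => x j + if j = i then 1 else 0, fun X hX => by
      rw [hsum]
      have hle := hx X hX
      split_ifs with hiX
      · have hne : ∑ j ∈ X, x j ≠ g X := fun h => hi X ((hT X).2 ⟨hX, h⟩) hiX
        omega
      · omega, rfl⟩
    rw [hsum] at this
    simp at this
  have hunion : ∀ X ∈ T, ∀ Y ∈ T, (X ∩ Y).Nonempty → X ∪ Y ∈ T := by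
    intro X hX Y hY hXY
    rw [hT] at hX hY ⊢
    have hU : (X ∪ Y).Nonempty := hX.1.mono Finset.subset_union_left
    refine ⟨hU, le_antisymm (hx _ hU) ?_⟩
    have h1 := hx _ hXY
    have h2 := Finset.sum_union_inter (s₁ := X) (s₂ := Y) (f := x)
    have h3 := hsub X Y hXY
    linarith [hX.2, hY.2]
  classical
  let Q : Finset (Finset V) := {X ∈ T | Maximal (· ∈ T) X}
  have hQ : ∀ X, X ∈ Q ↔ Maximal (· ∈ T) X := fun X => by
    simpa [Q] using fun h : Maximal (· ∈ T) X => h.prop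
  have hdisj : ∀ C ∈ Q, ∀ D ∈ Q, C ≠ D → Disjoint C D := by
    intro C hC D hD hne
    rw [hQ] at hC hD
    by_contra hCD
    have hU := hunion C hC.prop D hD.prop
      (Finset.not_disjoint_iff_nonempty_inter.1 hCD)
    exact hne ((hC.eq_of_le hU Finset.subset_union_left).trans
      (hD.eq_of_le hU Finset.subset_union_right).symm)
  have hbU : Q.biUnion id = Finset.univ := by
    refine Finset.eq_univ_of_forall fun i => ?_
    obtain ⟨X, hX, hi⟩ := hcover i
    obtain ⟨Y, hXY, hY⟩ := T.exists_le_maximal hX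
    exact Finset.mem_biUnion.2 ⟨Y, (hQ Y).2 hY, hXY hi⟩
  calc g Finset.univ ≤ ∑ C ∈ Q, g C :=
        hpart Q ⟨fun C hC => ((hT C).1 ((hQ C).1 hC).prop).1, hdisj, hbU⟩
    _ = ∑ C ∈ Q, ∑ i ∈ C, x i :=
        Finset.sum_congr rfl fun C hC => ((hT C).1 ((hQ C).1 hC).prop).2.symm
    _ = ∑ i, x i := by
        rw [← hbU]
        exact (Finset.sum_biUnion (t := id) hdisj).symm

/-- In the finite linear source model, if `P ∈ Π′(V)` attains `R_ACO(V)`, then there is a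
fractional optimal rate vector implementable by `(|P| − 1)`-packet-splitting. -/
theorem stmt_7 {V : Type*} [Fintype V] [DecidableEq V] (hV : 2 ≤ Fintype.card V)
    (H : Finset V → ℝ) (hH : IsPolymatroid H)
    (hint : ∀ X : Finset V, ∃ z : ℤ, H X = z) (R : ℝ)
    (hR : IsGreatest { s : ℝ | ∃ P : Finset (Finset V),
      IsPartitionOf Finset.univ P ∧ 2 ≤ P.card ∧ s = phi H P } R)
    (P : Finset (Finset V)) (hP : IsPartitionOf Finset.univ P) (hP2 : 2 ≤ P.card)
    (hPopt : phi H P = R) :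
    ∃ r : V → ℝ, r ∈ RCO H ∧ ∑ i, r i = R ∧
      ∀ i : V, ∃ z : ℤ, ((P.card : ℝ) - 1) * r i = z := by
  have : Nonempty V := Fintype.card_pos_iff.1 (by omega)
  choose h hh using hint
  have hP2' : (2 : ℝ) ≤ P.card := by exact_mod_cast hP2
  have hk : (0 : ℝ) < (P.card : ℝ) - 1 := by linarith
  have hN : ∑ C ∈ P, (H Finset.univ - H C) = ((P.card : ℝ) - 1) * R := by
    rw [← hPopt, phi]
    field_simp
  let g : Finset V → ℤ := fun X =>
    ((P.card : ℤ) - 1) * (h X - h Finset.univ) + ∑ C ∈ P, (h Finset.univ - h C)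
  have hg : ∀ X, (g X : ℝ) = ((P.card : ℝ) - 1) * (H X - H Finset.univ + R) := by
    intro X
    rw [mul_add, ← hN]
    simp [g, hh]
  obtain ⟨x, hx, hxV⟩ := exists_int_base_of_intersecting_submodular g
    (fun X Y _ => by
      rify
      simp only [hg]
      nlinarith [hH.2.2 X Y])
    (fun Q hQ => by
      rify
      simp only [hg]
      rw [← Finset.mul_sum]
      refine mul_le_mul_of_nonneg_left ?_ hk.le
      rcases Nat.lt_or_ge Q.card 2 with hlt | hge
      · rcases Nat.lt_or_ge Q.card 1 with h0 | h1
        · have hQ0 : Q = ∅ := Finset.card_eq_zero.1 (by omega)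
          have := hQ.2.2
          rw [hQ0, Finset.biUnion_empty] at this
          exact absurd this.symm Finset.univ_nonempty.ne_empty
        · obtain ⟨C, rfl⟩ := Finset.card_eq_one.1 (by omega : Q.card = 1)
          have hC : C = Finset.univ := by simpa using hQ.2.2
          simp [hC]
      · have hge' : (2 : ℝ) ≤ Q.card := by exact_mod_cast hge
        have hle := hR.2 ⟨Q, hQ, hge, rfl⟩
        rw [phi, div_le_iff₀ (by linarith)] at hle
        simp only [Finset.sum_add_distrib, Finset.sum_sub_distrib, Finset.sum_const,
          nsmul_eq_mul] at hle ⊢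
        linarith)
  have hsum : ∀ X : Finset V, ∑ i ∈ X, (x i : ℝ) / ((P.card : ℝ) - 1) =
      ((∑ i ∈ X, x i : ℤ) : ℝ) / ((P.card : ℝ) - 1) := fun X => by
    rw [← Finset.sum_div]
    push_cast
    rfl
  have hxR : ∑ i, (x i : ℝ) / ((P.card : ℝ) - 1) = R := by
    rw [hsum, hxV, hg, mul_div_cancel_left₀ _ hk.ne']
    ring
  refine ⟨fun i => (x i : ℝ) / ((P.card : ℝ) - 1), fun X hX => ?_, hxR, fun i => ⟨x i, ?_⟩⟩
  · have hle : ∑ i ∈ Finset.univ \ X, (x i : ℝ) / ((P.card : ℝ) - 1) ≤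
        H (Finset.univ \ X) - H Finset.univ + R := by
      rw [hsum, div_le_iff₀ hk, mul_comm, ← hg]
      exact_mod_cast hx _ (Finset.sdiff_nonempty.2 hX.2)
    have hadd := Finset.sum_sdiff (f := fun i => (x i : ℝ) / ((P.card : ℝ) - 1))
      (Finset.subset_univ X)
    linarith
  · exact mul_div_cancel₀ _ hk.ne'
end

section
/- Let H : 2^V → ℝ be a polymatroid rank function on a finite set V with |V| ≥ 2, let R := max_{P ∈ Π′(V)} φ(P), let α ∈ ℝ, and let P be a partition of V minimizing f#_α[P′] over all partitions P′ ∈ Π(V). Then: (i) if α < R, then |P| ≥ 2 and α < φ(P) ≤ R; (ii) if |P| ≥ 2 and φ(P) = α, then α = R. (This is the key monotone-convergence property underlying the MDA algorithm: each iteration α ← φ(P) strictly increases the estimate of R and the fixed point equals the minimum sum-rate.) -/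
/-- The value of `f#_α` on a partition `Q` is `|Q| α − Σ_{C∈Q} (H(V) − H(C))`. -/
theorem sum_fHash_eq_card_mul_sub {V : Type*} [Fintype V] [DecidableEq V]
    (H : Finset V → ℝ) (α : ℝ) {X : Finset V} {Q : Finset (Finset V)} (hQ : IsPartitionOf X Q) :
    ∑ C ∈ Q, fHash H α C = Q.card * α - ∑ C ∈ Q, (H Finset.univ - H C) := by
  rw [← nsmul_eq_mul, ← Finset.sum_const, ← Finset.sum_sub_distrib]
  refine Finset.sum_congr rfl fun C hC => ?_
  rw [fHash, if_neg (hQ.1 C hC).ne_empty]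
  ring

/-- For a partition into at least two parts, `f#_α[Q] = α + (|Q| − 1) (α − φ(Q))`. -/
theorem sum_fHash_eq_add_mul_sub_phi {V : Type*} [Fintype V] [DecidableEq V]
    (H : Finset V → ℝ) (α : ℝ) {X : Finset V} {Q : Finset (Finset V)} (hQ : IsPartitionOf X Q)
    (hcard : 2 ≤ Q.card) :
    ∑ C ∈ Q, fHash H α C = α + ((Q.card : ℝ) - 1) * (α - phi H Q) := by
  have hcard' : (2 : ℝ) ≤ Q.card := by exact_mod_cast hcard
  have hne : (Q.card : ℝ) - 1 ≠ 0 := by linarith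
  rw [sum_fHash_eq_card_mul_sub H α hQ, phi, mul_sub, mul_div_cancel₀ _ hne]
  ring

/-- A partition of a nonempty set into fewer than two parts is trivial. -/
theorem IsPartitionOf.eq_singleton {V : Type*} [DecidableEq V] {X : Finset V}
    {Q : Finset (Finset V)} (hQ : IsPartitionOf X Q) (hX : X.Nonempty) (hcard : Q.card < 2) :
    Q = {X} := by
  obtain ⟨-, -, hunion⟩ := hQ
  rcases Finset.card_le_one_iff_subset_singleton.mp (Nat.le_of_lt_succ hcard) with ⟨C, hC⟩
  rcases Finset.subset_singleton_iff.mp hC with rfl | rfl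
  · exact absurd hunion.symm (by simpa using hX.ne_empty)
  · simpa using hunion

/-- `f#_α` takes the value `α` on the ground set. -/
theorem fHash_univ {V : Type*} [Fintype V] [DecidableEq V] [Nonempty V]
    (H : Finset V → ℝ) (α : ℝ) : fHash H α Finset.univ = α := by
  simp [fHash, Finset.univ_nonempty.ne_empty]

/-- Monotone-convergence property of the MDA updates: if `P` minimizes `f#_α[·]` over the
partitions of `V`, then (i) `α < R` implies `|P| ≥ 2` and `α < φ(P) ≤ R`, and (ii) if
`|P| ≥ 2` and `φ(P) = α` then `α = R`, where `R = max_{P′ ∈ Π′(V)} φ(P′)`. -/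
theorem stmt_10 {V : Type*} [Fintype V] [DecidableEq V] (hV : 2 ≤ Fintype.card V)
    (H : Finset V → ℝ) (hH : IsPolymatroid H) (R α : ℝ)
    (hR : IsGreatest { s : ℝ | ∃ P : Finset (Finset V),
      IsPartitionOf Finset.univ P ∧ 2 ≤ P.card ∧ s = phi H P } R)
    (P : Finset (Finset V)) (hP : IsPartitionOf Finset.univ P)
    (hmin : ∀ Q : Finset (Finset V), IsPartitionOf Finset.univ Q →
      ∑ C ∈ P, fHash H α C ≤ ∑ C ∈ Q, fHash H α C) :
    (α < R → 2 ≤ P.card ∧ α < phi H P ∧ phi H P ≤ R) ∧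
    (2 ≤ P.card → phi H P = α → α = R) := by
  have : Nonempty V := Fintype.card_pos_iff.mp (by omega)
  obtain ⟨⟨Q, hQ, hQcard, rfl⟩, hub⟩ := hR
  have hminQ := hmin Q hQ
  rw [sum_fHash_eq_add_mul_sub_phi H α hQ hQcard] at hminQ
  have hQpos : (0 : ℝ) < (Q.card : ℝ) - 1 := by
    have : (2 : ℝ) ≤ Q.card := by exact_mod_cast hQcard
    linarith
  refine ⟨fun hα => ?_, fun hPcard hφ => ?_⟩
  · have hlt : ((Q.card : ℝ) - 1) * (α - phi H Q) < 0 :=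
      mul_neg_of_pos_of_neg hQpos (by linarith)
    have hPcard : 2 ≤ P.card := by
      by_contra! hcard
      rw [hP.eq_singleton Finset.univ_nonempty hcard, Finset.sum_singleton, fHash_univ] at hminQ
      linarith
    refine ⟨hPcard, ?_, hub ⟨P, hP, hPcard, rfl⟩⟩
    rw [sum_fHash_eq_add_mul_sub_phi H α hP hPcard] at hminQ
    have hPpos : (0 : ℝ) < (P.card : ℝ) - 1 := by
      have : (2 : ℝ) ≤ P.card := by exact_mod_cast hPcard
      linarith
    by_contra! hle
    have := mul_nonneg hPpos.le (sub_nonneg.mpr hle)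
    linarith
  · have hle : phi H P ≤ phi H Q := hub ⟨P, hP, hPcard, rfl⟩
    rw [sum_fHash_eq_add_mul_sub_phi H α hP hPcard, hφ, sub_self, mul_zero, add_zero,
      le_add_iff_nonneg_right, mul_nonneg_iff_of_pos_left hQpos] at hminQ
    linarith
end

section
/- Let H : 2^V → ℝ be a polymatroid rank function on a finite set V, let α ∈ ℝ, let W ⊆ V with i ∈ W, and let r ∈ ℝ^V satisfy r_j ≤ 0 for every j ∈ V∖W. Then min { f#_α(X) − r(X) : i ∈ X ⊆ V } = min { f#_α(X) − r(X) : i ∈ X ⊆ W }; moreover, the problem min { f#_α(X) − r(X) : i ∈ X ⊆ V } has a unique inclusion-wise smallest minimizer, and this smallest minimizer is contained in W. -/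
/-- The function `f#_α − r` is submodular on intersecting pairs of sets. -/
theorem IsPolymatroid.fHash_sub_sum_union_add_inter_le {V : Type*} [Fintype V] [DecidableEq V]
    {H : Finset V → ℝ} (hH : IsPolymatroid H) (α : ℝ) (r : V → ℝ) {X Y : Finset V}
    (h : (X ∩ Y).Nonempty) :
    (fHash H α (X ∪ Y) - ∑ j ∈ X ∪ Y, r j) + (fHash H α (X ∩ Y) - ∑ j ∈ X ∩ Y, r j) ≤
      (fHash H α X - ∑ j ∈ X, r j) + (fHash H α Y - ∑ j ∈ Y, r j) := by
  have hX : X ≠ ∅ := (h.mono Finset.inter_subset_left).ne_empty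
  have hY : Y ≠ ∅ := (h.mono Finset.inter_subset_right).ne_empty
  have hU : X ∪ Y ≠ ∅ :=
    (h.mono (Finset.inter_subset_left.trans Finset.subset_union_left)).ne_empty
  have hsum := Finset.sum_union_inter (s₁ := X) (s₂ := Y) (f := r)
  have hsub := hH.2.2 X Y
  simp only [fHash, if_neg hX, if_neg hY, if_neg hU, if_neg h.ne_empty]
  linarith

/-- Dropping elements where `r ≤ 0` does not increase `f#_α − r`, as long as the set stays
nonempty. -/
theorem IsPolymatroid.fHash_sub_sum_inter_le {V : Type*} [Fintype V] [DecidableEq V]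
    {H : Finset V → ℝ} (hH : IsPolymatroid H) (α : ℝ) {r : V → ℝ} {X W : Finset V}
    (hr : ∀ j, j ∉ W → r j ≤ 0) (h : (X ∩ W).Nonempty) :
    fHash H α (X ∩ W) - ∑ j ∈ X ∩ W, r j ≤ fHash H α X - ∑ j ∈ X, r j := by
  have hX : X ≠ ∅ := (h.mono Finset.inter_subset_left).ne_empty
  have hsum : ∑ j ∈ X, r j ≤ ∑ j ∈ X ∩ W, r j := by
    rw [← Finset.sum_inter_add_sum_sdiff X W r]
    have := Finset.sum_nonpos fun j (hj : j ∈ X \ W) => hr j (Finset.mem_sdiff.mp hj).2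
    linarith
  have hmono := hH.2.1 X (X ∩ W) Finset.inter_subset_left
  simp only [fHash, if_neg hX, if_neg h.ne_empty]
  linarith

/-- A function that is submodular on the sets containing `i` has a smallest minimizer among
those sets. -/
theorem exists_smallest_minimizer_of_submodular {V : Type*} [Fintype V] [DecidableEq V]
    {g : Finset V → ℝ} {i : V}
    (hg : ∀ X Y, i ∈ X → i ∈ Y → g (X ∪ Y) + g (X ∩ Y) ≤ g X + g Y) :
    ∃ M, i ∈ M ∧ (∀ X, i ∈ X → g M ≤ g X) ∧ ∀ X, i ∈ X → g X = g M → M ⊆ X := by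
  obtain ⟨A, hA, hAmin⟩ := Finset.exists_min_image
    (Finset.univ.filter fun X : Finset V => i ∈ X) g ⟨{i}, by simp⟩
  simp only [Finset.mem_filter, Finset.mem_univ, true_and] at hA hAmin
  obtain ⟨M, hM, hMmin⟩ := Finset.exists_min_image
    (Finset.univ.filter fun X : Finset V => i ∈ X ∧ g X = g A) Finset.card ⟨A, by simp [hA]⟩
  simp only [Finset.mem_filter, Finset.mem_univ, true_and] at hM hMmin
  refine ⟨M, hM.1, fun X hX => hM.2.trans_le (hAmin X hX), fun X hX hXM => ?_⟩
  have hinter : i ∈ M ∩ X := Finset.mem_inter.mpr ⟨hM.1, hX⟩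
  have hle : g (M ∩ X) ≤ g A := by
    linarith [hg M X hM.1 hX, hAmin (M ∪ X) (Finset.mem_union_left _ hM.1), hM.2]
  have hcard := hMmin (M ∩ X) ⟨hinter, hle.antisymm (hAmin _ hinter)⟩
  exact Finset.inter_eq_left.mp (Finset.eq_of_subset_of_card_le Finset.inter_subset_left hcard)

/-- If `r_j ≤ 0` outside `W` and `i ∈ W`, then the saturation-capacity minimization
over all sets containing `i` equals the one over subsets of `W`; moreover there is a
unique inclusion-wise smallest minimizer, and it is contained in `W`. -/
theorem stmt_12 {V : Type*} [Fintype V] [DecidableEq V]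
    (H : Finset V → ℝ) (hH : IsPolymatroid H) (α : ℝ)
    (W : Finset V) (i : V) (hi : i ∈ W)
    (r : V → ℝ) (hr : ∀ j : V, j ∉ W → r j ≤ 0) :
    sInf { s : ℝ | ∃ X : Finset V, i ∈ X ∧ s = fHash H α X - ∑ j ∈ X, r j } =
      sInf { s : ℝ | ∃ X : Finset V, i ∈ X ∧ X ⊆ W ∧ s = fHash H α X - ∑ j ∈ X, r j } ∧
    (∃! Xhat : Finset V,
      i ∈ Xhat ∧
      fHash H α Xhat - ∑ j ∈ Xhat, r j =
        sInf { s : ℝ | ∃ X : Finset V, i ∈ X ∧ s = fHash H α X - ∑ j ∈ X, r j } ∧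
      ∀ X : Finset V, i ∈ X →
        fHash H α X - ∑ j ∈ X, r j =
          sInf { s : ℝ | ∃ X : Finset V, i ∈ X ∧ s = fHash H α X - ∑ j ∈ X, r j } →
        Xhat ⊆ X) ∧
    (∀ Xhat : Finset V,
      (i ∈ Xhat ∧
       fHash H α Xhat - ∑ j ∈ Xhat, r j =
         sInf { s : ℝ | ∃ X : Finset V, i ∈ X ∧ s = fHash H α X - ∑ j ∈ X, r j } ∧
       ∀ X : Finset V, i ∈ X →
         fHash H α X - ∑ j ∈ X, r j =
           sInf { s : ℝ | ∃ X : Finset V, i ∈ X ∧ s = fHash H α X - ∑ j ∈ X, r j } →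
         Xhat ⊆ X) →
      Xhat ⊆ W) := by
  obtain ⟨M, hiM, hMmin, hMsub⟩ := exists_smallest_minimizer_of_submodular
    (g := fun X => fHash H α X - ∑ j ∈ X, r j) (i := i) fun X Y hX hY =>
      hH.fHash_sub_sum_union_add_inter_le α r ⟨i, Finset.mem_inter.mpr ⟨hX, hY⟩⟩
  have hMW : M ⊆ W := by
    have hiMW : i ∈ M ∩ W := Finset.mem_inter.mpr ⟨hiM, hi⟩
    exact (hMsub _ hiMW ((hH.fHash_sub_sum_inter_le α hr ⟨i, hiMW⟩).antisymm
      (hMmin _ hiMW))).trans Finset.inter_subset_right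
  have hinf : sInf { s : ℝ | ∃ X : Finset V, i ∈ X ∧ s = fHash H α X - ∑ j ∈ X, r j } =
      fHash H α M - ∑ j ∈ M, r j :=
    IsLeast.csInf_eq ⟨⟨M, hiM, rfl⟩, by rintro _ ⟨X, hX, rfl⟩; exact hMmin X hX⟩
  have hinfW :
      sInf { s : ℝ | ∃ X : Finset V, i ∈ X ∧ X ⊆ W ∧ s = fHash H α X - ∑ j ∈ X, r j } =
        fHash H α M - ∑ j ∈ M, r j :=
    IsLeast.csInf_eq ⟨⟨M, hiM, hMW, rfl⟩, by rintro _ ⟨X, hX, -, rfl⟩; exact hMmin X hX⟩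
  rw [hinf, hinfW]
  exact ⟨rfl, ⟨M, ⟨hiM, rfl, hMsub⟩, fun Y ⟨hiY, hY, hYsub⟩ =>
    (hYsub M hiM rfl).antisymm (hMsub Y hiY hY)⟩,
    fun Y ⟨_, _, hYsub⟩ => (hYsub M hiM rfl).trans hMW⟩
end

section
/- Let f : 2^V → ℝ be a normalized intersecting submodular set function on a finite set V (f(∅) = 0 and f(X) + f(Y) ≥ f(X ∪ Y) + f(X ∩ Y) for all X, Y ⊆ V with X ∩ Y ≠ ∅), let r ∈ ℝ^V satisfy r(X) ≤ f(X) for all X ⊆ V, and let P be a partition of V such that r(C) = f(C) for every C ∈ P with |C| > 1. Then for every i ∈ V: (a) for every X with i ∈ X ⊆ V, the fused set Ỹ = ⋃{ C ∈ P : C ∩ X ≠ ∅ } satisfies f(Ỹ) − r(Ỹ) ≤ f(X) − r(X); and consequently (b) min { f(X) − r(X) : i ∈ X ⊆ V } = min { f(⋃_{C∈U} C) − r(⋃_{C∈U} C) : U ⊆ P, i ∈ ⋃_{C∈U} C }. -/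
/-- The excess `f(·) − r(·)` inherits the intersecting submodular inequality of `f`. -/
theorem excess_union_add_inter_le {V : Type*} [DecidableEq V] {f : Finset V → ℝ}
    (hsub : ∀ X Y : Finset V, (X ∩ Y).Nonempty → f (X ∪ Y) + f (X ∩ Y) ≤ f X + f Y)
    (r : V → ℝ) {X Y : Finset V} (hXY : (X ∩ Y).Nonempty) :
    (f (X ∪ Y) - ∑ j ∈ X ∪ Y, r j) + (f (X ∩ Y) - ∑ j ∈ X ∩ Y, r j) ≤
      (f X - ∑ j ∈ X, r j) + (f Y - ∑ j ∈ Y, r j) := by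
  linarith [hsub X Y hXY, Finset.sum_union_inter (s₁ := X) (s₂ := Y) (f := r)]

/-- Adding sets that meet `X`, each of them tight or with at most one element, does not
increase `f(·) − r(·)`. -/
theorem excess_union_biUnion_le {V : Type*} [DecidableEq V] {f : Finset V → ℝ}
    (hsub : ∀ X Y : Finset V, (X ∩ Y).Nonempty → f (X ∪ Y) + f (X ∩ Y) ≤ f X + f Y)
    {r : V → ℝ} (hr : ∀ X : Finset V, ∑ j ∈ X, r j ≤ f X) (X : Finset V)
    (Q : Finset (Finset V)) (hmeet : ∀ C ∈ Q, (C ∩ X).Nonempty)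
    (htight : ∀ C ∈ Q, 1 < C.card → ∑ j ∈ C, r j = f C) :
    f (X ∪ Q.biUnion id) - ∑ j ∈ X ∪ Q.biUnion id, r j ≤ f X - ∑ j ∈ X, r j := by
  induction Q using Finset.induction_on with
  | empty => simp
  | insert C Q _ ih =>
    have ih := ih (fun D hD => hmeet D (Finset.mem_insert_of_mem hD))
      (fun D hD => htight D (Finset.mem_insert_of_mem hD))
    obtain ⟨x, hx⟩ := hmeet C (Finset.mem_insert_self C Q)
    obtain ⟨hxC, hxX⟩ := Finset.mem_inter.mp hx
    have hunion : X ∪ (insert C Q).biUnion id = (X ∪ Q.biUnion id) ∪ C := by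
      rw [Finset.biUnion_insert, id, Finset.union_comm C, Finset.union_assoc]
    rw [hunion]
    rcases le_or_gt C.card 1 with hcard | hcard
    · have hCX : C ⊆ X ∪ Q.biUnion id := fun y hy => by
        rw [Finset.card_le_one.mp hcard y hy x hxC]
        exact Finset.mem_union_left _ hxX
      rwa [Finset.union_eq_left.mpr hCX]
    · have hinter : ((X ∪ Q.biUnion id) ∩ C).Nonempty :=
        ⟨x, Finset.mem_inter.mpr ⟨Finset.mem_union_left _ hxX, hxC⟩⟩
      linarith [excess_union_add_inter_le hsub r hinter, hr ((X ∪ Q.biUnion id) ∩ C),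
        htight C (Finset.mem_insert_self C Q) hcard]

/-- Fusion lemma: with `r` in the polyhedron of the normalized intersecting submodular
function `f` and every non-singleton block of the partition `P` being `r`-tight,
(a) fusing the blocks of `P` meeting `X` does not increase `f(·) − r(·)`, and
(b) the saturation capacity at `i` can be computed over fused sets. -/
theorem stmt_13 {V : Type*} [Fintype V] [DecidableEq V]
    (f : Finset V → ℝ) (hnorm : f ∅ = 0)
    (hsub : ∀ X Y : Finset V, (X ∩ Y).Nonempty → f (X ∪ Y) + f (X ∩ Y) ≤ f X + f Y)
    (r : V → ℝ) (hr : ∀ X : Finset V, ∑ j ∈ X, r j ≤ f X)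
    (P : Finset (Finset V)) (hP : IsPartitionOf Finset.univ P)
    (htight : ∀ C ∈ P, 1 < C.card → ∑ j ∈ C, r j = f C) :
    ∀ i : V,
      (∀ X : Finset V, i ∈ X →
        f ((P.filter fun C => (C ∩ X).Nonempty).biUnion id) -
            ∑ j ∈ (P.filter fun C => (C ∩ X).Nonempty).biUnion id, r j ≤
          f X - ∑ j ∈ X, r j) ∧
      sInf { s : ℝ | ∃ X : Finset V, i ∈ X ∧ s = f X - ∑ j ∈ X, r j } =
        sInf { s : ℝ | ∃ U : Finset (Finset V), U ⊆ P ∧ i ∈ U.biUnion id ∧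
          s = f (U.biUnion id) - ∑ j ∈ U.biUnion id, r j } := by
  intro i
  obtain ⟨-, -, hcover⟩ := hP
  have hsubset (X : Finset V) :
      X ⊆ (P.filter fun C => (C ∩ X).Nonempty).biUnion id := fun x hx => by
    obtain ⟨C, hC, hxC⟩ := Finset.mem_biUnion.mp (hcover ▸ Finset.mem_univ x)
    exact Finset.mem_biUnion.mpr
      ⟨C, Finset.mem_filter.mpr ⟨hC, x, Finset.mem_inter.mpr ⟨hxC, hx⟩⟩, hxC⟩
  have hfuse (X : Finset V) :
      f ((P.filter fun C => (C ∩ X).Nonempty).biUnion id) -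
          ∑ j ∈ (P.filter fun C => (C ∩ X).Nonempty).biUnion id, r j ≤
        f X - ∑ j ∈ X, r j := by
    have h := excess_union_biUnion_le hsub hr X (P.filter fun C => (C ∩ X).Nonempty)
      (fun C hC => (Finset.mem_filter.mp hC).2)
      (fun C hC => htight C (Finset.mem_filter.mp hC).1)
    rwa [Finset.union_eq_right.mpr (hsubset X)] at h
  refine ⟨fun X _ => hfuse X, le_antisymm (csInf_le_csInf ?_ ?_ ?_) (le_csInf ?_ ?_)⟩
  · refine ⟨0, ?_⟩
    rintro s ⟨X, -, rfl⟩
    exact sub_nonneg.mpr (hr X)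
  · exact ⟨_, P, subset_rfl, hcover ▸ Finset.mem_univ i, rfl⟩
  · rintro s ⟨U, -, hi, rfl⟩
    exact ⟨_, hi, rfl⟩
  · exact ⟨_, {i}, Finset.mem_singleton_self i, rfl⟩
  · rintro s ⟨X, hi, rfl⟩
    refine csInf_le_of_le ⟨0, ?_⟩ ⟨_, Finset.filter_subset _ _, hsubset X hi, rfl⟩ (hfuse X)
    rintro s ⟨U, -, -, rfl⟩
    exact sub_nonneg.mpr (hr _)
end
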